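/- If S is a surface with empty boundary, then S is not properly homotopy equivalent to any graph. -/

import Mathlib

open Set Topology unitInterval

noncomputable section

/-- A map is proper-continuous: continuous and the preimage of every compact set is compact. -/
def ProperCont {X Y : Type*} [TopologicalSpace X] [TopologicalSpace Y] (f : X → Y) : Prop :=
  Continuous f ∧ ∀ K : Set Y, IsCompact K → IsCompact (f ⁻¹' K)

/-- `f` and `g` are homotopic. -/
def Htpc {X Y : Type*} [TopologicalSpace X] [TopologicalSpace Y] (f g : X → Y) : Prop :=
  ∃ H : X × I → Y, Continuous H ∧ (∀ x, H (x, 0) = f x) ∧ (∀ x, H (x, 1) = g x)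

/-- `f` and `g` are properly homotopic: joined by a homotopy which is itself a proper map. -/
def PHtpc {X Y : Type*} [TopologicalSpace X] [TopologicalSpace Y] (f g : X → Y) : Prop :=
  ∃ H : X × I → Y, ProperCont H ∧ (∀ x, H (x, 0) = f x) ∧ (∀ x, H (x, 1) = g x)

/-- `φ` is a proper homotopy equivalence with proper homotopy inverse `ψ`. -/
def IsPHEPair {X Y : Type*} [TopologicalSpace X] [TopologicalSpace Y]
    (φ : X → Y) (ψ : Y → X) : Prop :=
  ProperCont φ ∧ ProperCont ψ ∧ PHtpc (ψ ∘ φ) id ∧ PHtpc (φ ∘ ψ) id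

/-- `φ` is a proper homotopy equivalence (admitting some proper homotopy inverse). -/
def IsPHE {X Y : Type*} [TopologicalSpace X] [TopologicalSpace Y] (φ : X → Y) : Prop :=
  ∃ ψ : Y → X, IsPHEPair φ ψ

/-- `X` and `Y` are properly homotopy equivalent. -/
def PHEquivalent (X Y : Type*) [TopologicalSpace X] [TopologicalSpace Y] : Prop :=
  ∃ φ : X → Y, IsPHE φ

/-- The standard Möbius band, realized as a subset of `ℝ³`. -/
def MobiusBand : Set (ℝ × ℝ × ℝ) :=
  {p | ∃ u v : ℝ, |v| ≤ 1 / 2 ∧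
    p = ((1 + v * Real.cos (u / 2)) * Real.cos u,
         (1 + v * Real.cos (u / 2)) * Real.sin u,
         v * Real.sin (u / 2))}

/-- A surface: a connected, orientable (no embedded Möbius band), second-countable, Hausdorff
topological 2-manifold, possibly with boundary (locally modeled on the closed half-plane). -/
structure IsSurface (S : Type*) [TopologicalSpace S] : Prop where
  connected : ConnectedSpace S
  t2 : T2Space S
  secondCountable : SecondCountableTopology S
  locallyHalfPlane : ∀ x : S, ∃ (U : Set S) (V : Set {p : ℝ × ℝ // 0 ≤ p.2}),
    IsOpen U ∧ x ∈ U ∧ IsOpen V ∧ Nonempty (↥U ≃ₜ ↥V)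
  orientable : ¬ ∃ f : ↥MobiusBand → S, IsEmbedding f

/-- The boundary of a surface: the set of points having no open neighborhood
homeomorphic to `ℝ²`. -/
def Bd (S : Type*) [TopologicalSpace S] : Set S :=
  {x | ¬ ∃ U : Set S, IsOpen U ∧ x ∈ U ∧ Nonempty (↥U ≃ₜ (ℝ × ℝ))}

/-- The unit circle in the plane. -/
def Circ : Set (ℝ × ℝ) := {p | p.1 ^ 2 + p.2 ^ 2 = 1}

/-- A simple closed curve in `S`: the image of a topological embedding of the circle. -/
def IsSimpleClosedCurve {S : Type*} [TopologicalSpace S] (α : Set S) : Prop :=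
  ∃ f : ↥Circ → S, IsEmbedding f ∧ range f = α

/-- A boundary isolating curve: a simple closed curve `α ⊆ S ∖ ∂S` such that `S ∖ α` has
exactly two connected components `Y` and `Z` with `Y ∩ ∂S ≠ ∅`, `Z ∩ ∂S = ∅`, and
`Z ∪ α` noncompact. -/
def IsBoundaryIsolating {S : Type*} [TopologicalSpace S] (α : Set S) : Prop :=
  IsSimpleClosedCurve α ∧ α ∩ Bd S = ∅ ∧
  ∃ Y Z : Set S, Y ≠ Z ∧
    (∀ C : Set S, (∃ x ∈ αᶜ, C = connectedComponentIn αᶜ x) ↔ (C = Y ∨ C = Z)) ∧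
    (Y ∩ Bd S).Nonempty ∧ Z ∩ Bd S = ∅ ∧ ¬ IsCompact (Z ∪ α)

/-- The open part of the parametrizing interval of an edge. -/
def edgeInt : Set I := {t : I | 0 < (t : ℝ) ∧ (t : ℝ) < 1}

/-- A graph: a connected, locally finite, Hausdorff, 1-dimensional CW complex, presented by a
closed discrete vertex set and a set of characteristic maps of edges. -/
structure IsGraph (Γ : Type*) [TopologicalSpace Γ] : Prop where
  connected : ConnectedSpace Γ
  t2 : T2Space Γ
  cell_structure : ∃ (V : Set Γ) (E : Set C(I, Γ)),
    IsClosed V ∧ DiscreteTopology ↥V ∧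
    (∀ e ∈ E, e 0 ∈ V ∧ e 1 ∈ V) ∧
    (∀ e ∈ E, IsEmbedding (fun t : ↥edgeInt => e t.1)) ∧
    (∀ e ∈ E, (⇑e '' edgeInt) ∩ V = ∅) ∧
    (∀ e ∈ E, ∀ e' ∈ E, e ≠ e' → (⇑e '' edgeInt) ∩ (⇑e' '' edgeInt) = ∅) ∧
    (V ∪ ⋃ e ∈ E, ⇑e '' edgeInt) = univ ∧
    (∀ x : Γ, ∃ U : Set Γ, IsOpen U ∧ x ∈ U ∧ {e ∈ E | (range ⇑e ∩ U).Nonempty}.Finite) ∧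
    (∀ A : Set Γ, (∀ e ∈ E, IsClosed (⇑e ⁻¹' A)) → IsClosed (A ∩ ⋃ e ∈ E, range ⇑e)) ∧
    (∀ v ∈ V, (∃ e ∈ E, v ∈ range ⇑e) ∨ (univ : Set Γ) = {v})

/-- A finite graph: a graph with finitely many cells, equivalently a compact graph. -/
def IsFiniteGraph (Γ : Type*) [TopologicalSpace Γ] : Prop :=
  IsGraph Γ ∧ CompactSpace Γ

/-- A deformation retraction of `S` onto the subspace `A`. -/
def IsDeformationRetraction {S : Type*} [TopologicalSpace S] (H : S × I → S) (A : Set S) :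
    Prop :=
  Continuous H ∧ (∀ x, H (x, 0) = x) ∧ (∀ x, H (x, 1) ∈ A) ∧ (∀ a ∈ A, H (a, 1) = a)

/-- A proper deformation retraction of `S` onto the subspace `A`. -/
def IsProperDeformationRetraction {S : Type*} [TopologicalSpace S] (H : S × I → S)
    (A : Set S) : Prop :=
  ProperCont H ∧ (∀ x, H (x, 0) = x) ∧ (∀ x, H (x, 1) ∈ A) ∧ (∀ a ∈ A, H (a, 1) = a)

/-- An end of a space, recorded as a compatible choice of a connected component of the
complement of each compact set. -/
def IsEndFn {Γ : Type*} [TopologicalSpace Γ] (s : Set Γ → Set Γ) : Prop :=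
  (∀ K : Set Γ, IsCompact K → ∃ x ∈ Kᶜ, s K = connectedComponentIn Kᶜ x) ∧
  (∀ K K' : Set Γ, IsCompact K → IsCompact K' → K ⊆ K' → s K' ⊆ s K)

/-- A proper map induces the identity on the space of ends. -/
def InducesIdOnEnds {Γ : Type*} [TopologicalSpace Γ] (g : Γ → Γ) : Prop :=
  ∀ s : Set Γ → Set Γ, IsEndFn s → ∀ K : Set Γ, IsCompact K →
    ∃ K' : Set Γ, IsCompact K' ∧ K ⊆ K' ∧ g '' s K' ⊆ s K

/-- An isotopy between `f` and `g` relative to the set `B`: a homotopy each of whose time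
slices is a homeomorphism fixing `B` pointwise. -/
def IsotopicRel {S : Type*} [TopologicalSpace S] (B : Set S) (f g : S → S) : Prop :=
  ∃ H : S × I → S, Continuous H ∧ (∀ x, H (x, 0) = f x) ∧ (∀ x, H (x, 1) = g x) ∧
    ∀ t : I, IsHomeomorph (fun x => H (x, t)) ∧ ∀ x ∈ B, H (x, t) = x

/-- An isotopy between `f` and `g`: a homotopy each of whose time slices is a
homeomorphism. -/
def Isotopic {S : Type*} [TopologicalSpace S] (f g : S → S) : Prop :=
  ∃ H : S × I → S, Continuous H ∧ (∀ x, H (x, 0) = f x) ∧ (∀ x, H (x, 1) = g x) ∧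
    ∀ t : I, IsHomeomorph (fun x => H (x, t))

/-- Representatives for the mapping class group of a surface: homeomorphisms fixing the
boundary pointwise, with the compact-open topology. -/
abbrev MCGRep (S : Type*) [TopologicalSpace S] :=
  {f : C(S, S) // IsHomeomorph ⇑f ∧ ∀ x ∈ Bd S, f x = x}

/-- The isotopy-rel-boundary relation on representatives. -/
def mcgRel (S : Type*) [TopologicalSpace S] (f g : MCGRep S) : Prop :=
  IsotopicRel (Bd S) ⇑f.1 ⇑g.1

/-- The mapping class group `Map(S)` of a surface as a topological space: homeomorphisms
fixing the boundary pointwise, modulo isotopy rel boundary, with the quotient of the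
compact-open topology. -/
abbrev MCG (S : Type*) [TopologicalSpace S] := Quot (mcgRel S)

/-- Representatives for the extended mapping class group: all homeomorphisms. -/
abbrev ExRep (S : Type*) [TopologicalSpace S] := {f : C(S, S) // IsHomeomorph ⇑f}

/-- The (free) isotopy relation on representatives. -/
def exRel (S : Type*) [TopologicalSpace S] (f g : ExRep S) : Prop :=
  Isotopic ⇑f.1 ⇑g.1

/-- The extended mapping class group `ExMap(S)` as a topological space. -/
abbrev ExMCG (S : Type*) [TopologicalSpace S] := Quot (exRel S)

/-- Representatives for the mapping class group of a graph: proper homotopy equivalences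
admitting a proper homotopy inverse, with the compact-open topology. -/
abbrev GphRep (Γ : Type*) [TopologicalSpace Γ] := {g : C(Γ, Γ) // IsPHE ⇑g}

/-- The proper homotopy relation on representatives. -/
def gphRel (Γ : Type*) [TopologicalSpace Γ] (g h : GphRep Γ) : Prop :=
  PHtpc ⇑g.1 ⇑h.1

/-- The mapping class group `Map(Γ)` of a graph as a topological space. -/
abbrev GphMCG (Γ : Type*) [TopologicalSpace Γ] := Quot (gphRel Γ)

/-- Rotation of the unit circle by angle `a`. -/
def rotC (a : ℝ) (p : ↥Circ) : ↥Circ :=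
  ⟨(p.1.1 * Real.cos a - p.1.2 * Real.sin a, p.1.1 * Real.sin a + p.1.2 * Real.cos a), by
    have h : p.1.1 ^ 2 + p.1.2 ^ 2 = 1 := p.2
    have h2 := Real.sin_sq_add_cos_sq a
    simp only [Circ, Set.mem_setOf_eq]
    nlinarith [h, h2]⟩

/-- Reflection of the unit circle (the standard orientation-reversing involution). -/
def circConj (p : ↥Circ) : ↥Circ :=
  ⟨(p.1.1, -p.1.2), by
    have h : p.1.1 ^ 2 + p.1.2 ^ 2 = 1 := p.2
    simp only [Circ, Set.mem_setOf_eq]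
    nlinarith [h]⟩

/-- The midpoint of the unit interval. -/
def ihalf : I := ⟨1 / 2, by norm_num [Set.mem_Icc]⟩

/-- `f` is the twist map determined by an embedded annular collar `e`:
`e(θ,t) ↦ e(θ + 2πt, t)` on the image of `e` and the identity elsewhere. -/
def IsTwistMap {S : Type*} [TopologicalSpace S] (e : ↥Circ × I → S) (f : S → S) : Prop :=
  IsEmbedding e ∧
  (∀ (θ : ↥Circ) (t : I), f (e (θ, t)) = e (rotC (2 * Real.pi * (t : ℝ)) θ, t)) ∧
  (∀ x, x ∉ range e → f x = x)

/-- A Dehn twist about a compact boundary component of `S`. -/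
def IsCptBdTwist {S : Type*} [TopologicalSpace S] (f : S → S) : Prop :=
  ∃ e : ↥Circ × I → S, IsTwistMap e f ∧
    (∃ x ∈ Bd S, range (fun θ : ↥Circ => e (θ, 0)) = connectedComponentIn (Bd S) x ∧
      IsCompact (connectedComponentIn (Bd S) x)) ∧
    (∀ (θ : ↥Circ) (t : I), (t : ℝ) ≠ 0 → e (θ, t) ∉ Bd S)

/-- The closed unit disk in the plane. -/
def ClosedDisk : Set (ℝ × ℝ) := {p | p.1 ^ 2 + p.2 ^ 2 ≤ 1}

/-- A Dehn twist about a degenerate boundary chain: a twist supported in an annulus disjoint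
from `∂S` whose core curve cuts off a piece homeomorphic to a closed disk with a nonempty
proper closed subset removed from its boundary circle. -/
def IsDegChainTwist {S : Type*} [TopologicalSpace S] (f : S → S) : Prop :=
  ∃ e : ↥Circ × I → S, IsTwistMap e f ∧ range e ∩ Bd S = ∅ ∧
    ∃ x ∈ (range fun θ : ↥Circ => e (θ, ihalf))ᶜ,
      ∃ J : Set (ℝ × ℝ), J ⊆ Circ ∧ IsClosed J ∧ J.Nonempty ∧ J ≠ Circ ∧
        Nonempty
          (↥(closure (connectedComponentIn (range fun θ : ↥Circ => e (θ, ihalf))ᶜ x)) ≃ₜ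
            ↥(ClosedDisk \ J))

/-- `f` is a finite composition of maps satisfying the predicate `P`. -/
def IsProductOf {S : Type*} [TopologicalSpace S] (P : (S → S) → Prop) (f : S → S) : Prop :=
  ∃ L : List (S → S), (∀ g ∈ L, P g) ∧ f = L.foldr (· ∘ ·) id

/-- The closed half-strip `[0,∞) × [0,1]`. -/
def HalfStrip : Set (ℝ × ℝ) := {p | 0 ≤ p.1 ∧ 0 ≤ p.2 ∧ p.2 ≤ 1}

/-- The closed strip `ℝ × [0,1]`. -/
def FullStrip : Set (ℝ × ℝ) := {p | 0 ≤ p.2 ∧ p.2 ≤ 1}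

/-- A closed annulus in the plane. -/
def AnnulusSet : Set (ℝ × ℝ) := {p | 1 ≤ p.1 ^ 2 + p.2 ^ 2 ∧ p.1 ^ 2 + p.2 ^ 2 ≤ 4}

/-- A surface is sporadic if it is homeomorphic to the closed disk, the half-strip, the
strip, or the annulus. -/
def IsSporadic (S : Type*) [TopologicalSpace S] : Prop :=
  Nonempty (S ≃ₜ ↥ClosedDisk) ∨ Nonempty (S ≃ₜ ↥HalfStrip) ∨
    Nonempty (S ≃ₜ ↥FullStrip) ∨ Nonempty (S ≃ₜ ↥AnnulusSet)

/-- A parametrization of a compact boundary component of `S` by the circle. -/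
def IsCptBdParam {S : Type*} [TopologicalSpace S] (β : ↥Circ → S) : Prop :=
  IsEmbedding β ∧ ∃ x ∈ Bd S, range β = connectedComponentIn (Bd S) x ∧
    IsCompact (range β)

/-- A proper parametrization of a noncompact boundary component of `S` by the line. -/
def IsNcptBdParam {S : Type*} [TopologicalSpace S] (β : ℝ → S) : Prop :=
  IsEmbedding β ∧ ProperCont β ∧ ∃ x ∈ Bd S, range β = connectedComponentIn (Bd S) x ∧
    ¬ IsCompact (range β)

/-- `g` fixes (up to homotopy, resp. proper homotopy, and preserving orientations) each
curve and line of the collection `B` of `φ'`-images of boundary components: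
membership in `Map(Γ, B)`. -/
def FixesBdryImages {S : Type*} [TopologicalSpace S] (G : Set S) (φ' : S → ↥G)
    (g : ↥G → ↥G) : Prop :=
  (∀ β : ↥Circ → S, IsCptBdParam β → Htpc (g ∘ φ' ∘ β) (φ' ∘ β)) ∧
  (∀ β : ℝ → S, IsNcptBdParam β → PHtpc (g ∘ φ' ∘ β) (φ' ∘ β))

/-- `g` preserves the collection `B` of `φ'`-images of boundary components, possibly
permuting its members and reversing orientations: membership in `Map*(Γ, B)`. -/
def PermutesBdryImages {S : Type*} [TopologicalSpace S] (G : Set S) (φ' : S → ↥G)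
    (g : ↥G → ↥G) : Prop :=
  (∀ β : ↥Circ → S, IsCptBdParam β → ∃ β' : ↥Circ → S, IsCptBdParam β' ∧
    (Htpc (g ∘ φ' ∘ β) (φ' ∘ β') ∨ Htpc (g ∘ φ' ∘ β) (φ' ∘ β' ∘ circConj))) ∧
  (∀ β : ℝ → S, IsNcptBdParam β → ∃ β' : ℝ → S, IsNcptBdParam β' ∧
    (PHtpc (g ∘ φ' ∘ β) (φ' ∘ β') ∨ PHtpc (g ∘ φ' ∘ β) (φ' ∘ β' ∘ (fun r : ℝ => -r))))

end

namespace AlexSpanier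

open Filter

/-- The coboundary of a 0-cochain. -/
def d0 {X : Type*} (f : X → ZMod 2) (x y : X) : ZMod 2 := f x + f y

/-- The coboundary of a 1-cochain. -/
def d1 {X : Type*} (b : X → X → ZMod 2) (x y z : X) : ZMod 2 := b y z + b x z + b x y

/-- The coboundary of a 2-cochain. -/
def d2 {X : Type*} (c : X → X → X → ZMod 2) (x y z w : X) : ZMod 2 :=
  c y z w + c x z w + c x y w + c x y z

/-- A set on which the 1-cochain `b` is a cocycle. -/
def CocycleOn1 {X : Type*} (b : X → X → ZMod 2) (T : Set X) : Prop :=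
  ∀ x ∈ T, ∀ y ∈ T, ∀ z ∈ T, d1 b x y z = 0

/-- A set on which the 2-cochain `c` is a cocycle. -/
def CocycleOn2 {X : Type*} (c : X → X → X → ZMod 2) (T : Set X) : Prop :=
  ∀ x ∈ T, ∀ y ∈ T, ∀ z ∈ T, ∀ w ∈ T, d2 c x y z w = 0

/-- Pullback of a 1-cochain. -/
def pull1 {X Y : Type*} (f : X → Y) (b : Y → Y → ZMod 2) (x y : X) : ZMod 2 := b (f x) (f y)

/-- Pullback of a 2-cochain. -/
def pull2 {X Y : Type*} (f : X → Y) (c : Y → Y → Y → ZMod 2) (x y z : X) : ZMod 2 :=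
  c (f x) (f y) (f z)

section Algebra

variable {X Y : Type*}

lemma d1_d0 (f : X → ZMod 2) : d1 (d0 f) = 0 := by
  funext x y z
  simp only [d1, d0, Pi.zero_apply]
  grind

lemma d2_d1 (b : X → X → ZMod 2) (x y z w : X) : d2 (d1 b) x y z w = 0 := by
  simp only [d2, d1]
  grind

lemma d0_add (f g : X → ZMod 2) : d0 (f + g) = d0 f + d0 g := by
  funext x y
  simp only [d0, Pi.add_apply]
  ring

lemma d1_add (b b' : X → X → ZMod 2) : d1 (b + b') = d1 b + d1 b' := by
  funext x y z
  simp only [d1, Pi.add_apply]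
  ring

lemma d1_zero : d1 (0 : X → X → ZMod 2) = 0 := by
  funext x y z
  simp [d1]

lemma d1_sum {ι : Type*} (s : Finset ι) (b : ι → X → X → ZMod 2) :
    d1 (∑ i ∈ s, b i) = ∑ i ∈ s, d1 (b i) := by
  classical
  induction s using Finset.induction_on with
  | empty => simp [d1_zero]
  | insert a s ha ih => rw [Finset.sum_insert ha, Finset.sum_insert ha, d1_add, ih]

lemma add_self1 (b : X → X → ZMod 2) : b + b = 0 := by
  funext x y
  exact CharTwo.add_self_eq_zero _

lemma add_self2 (c : X → X → X → ZMod 2) : c + c = 0 := by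
  funext x y z
  exact CharTwo.add_self_eq_zero _

lemma pull2_d1 (f : X → Y) (b : Y → Y → ZMod 2) : pull2 f (d1 b) = d1 (pull1 f b) := rfl

lemma pull1_d0 (f : X → Y) (g : Y → ZMod 2) : pull1 f (d0 g) = d0 (g ∘ f) := rfl

/-- The prism operator between two maps, applied to a 2-cochain. -/
def prism (f g : X → Y) (c : Y → Y → Y → ZMod 2) (x y : X) : ZMod 2 :=
  c (f x) (f y) (g y) + c (f x) (g x) (g y)

lemma d1_prism {f g : X → Y} {c : Y → Y → Y → ZMod 2} {T : Set Y} (hT : CocycleOn2 c T)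
    {x y z : X} (hfx : f x ∈ T) (hfy : f y ∈ T) (hfz : f z ∈ T)
    (hgx : g x ∈ T) (hgy : g y ∈ T) (hgz : g z ∈ T) :
    c (f x) (f y) (f z) + c (g x) (g y) (g z) = d1 (prism f g c) x y z := by
  have h1 := hT _ hfx _ hfy _ hfz _ hgz
  have h2 := hT _ hfx _ hfy _ hgy _ hgz
  have h3 := hT _ hfx _ hgx _ hgy _ hgz
  simp only [d2, d1, prism] at *
  grind

lemma d0_prism {f g : X → Y} {b : Y → Y → ZMod 2} {T : Set Y} (hT : CocycleOn1 b T)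
    {x y : X} (hfx : f x ∈ T) (hfy : f y ∈ T) (hgx : g x ∈ T) (hgy : g y ∈ T) :
    b (f x) (f y) + b (g x) (g y) = d0 (fun x => b (f x) (g x)) x y := by
  have h1 := hT _ hfx _ hfy _ hgy
  have h2 := hT _ hfx _ hgx _ hgy
  simp only [d1, d0] at *
  grind

/-- A choice of one element from each unordered pair. -/
lemma exists_pair_choice (Y : Type*) :
    ∃ m : Y → Y → Y, (∀ p q, m p q = m q p) ∧ (∀ p q, m p q = p ∨ m p q = q) := by
  let : LinearOrder Y := IsWellOrder.linearOrder WellOrderingRel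
  exact ⟨min, min_comm, min_choice⟩

/-- A 2-cocycle pulled back along a map with at most two values is a coboundary. -/
lemma d1_pair {m : Y → Y → Y} (hm : ∀ p q, m p q = m q p) (hm' : ∀ p q, m p q = p ∨ m p q = q)
    {c : Y → Y → Y → ZMod 2} {p q : Y} (hc : CocycleOn2 c {p, q}) {x y z : Y}
    (hx : x ∈ ({p, q} : Set Y)) (hy : y ∈ ({p, q} : Set Y)) (hz : z ∈ ({p, q} : Set Y)) :
    d1 (fun x y => c (m x y) x y) x y z = c x y z := by
  wlog hpq : m p q = p generalizing p q
  · refine this (p := q) (q := p) (by rwa [pair_comm]) (by rwa [pair_comm]) (by rwa [pair_comm])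
      (by rwa [pair_comm]) ?_
    rw [hm]
    exact (hm' p q).resolve_left hpq
  have hqp : m q p = p := by rw [hm, hpq]
  have hpp : m p p = p := by simpa using hm' p p
  have hqq : m q q = q := by simpa using hm' q q
  have hp : p ∈ ({p, q} : Set Y) := by simp
  have hq : q ∈ ({p, q} : Set Y) := by simp
  have h1 := hc p hp p hp p hp q hq
  have h2 := hc q hq q hq q hq p hp
  have h3 := hc p hp q hq q hq q hq
  have h4 := hc q hq p hp p hp p hp
  have h5 := hc p hp q hq p hp q hq
  have h6 := hc p hp q hq q hq p hp
  have h7 := hc p hp p hp q hq q hq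
  simp only [d2] at h1 h2 h3 h4 h5 h6 h7
  rcases hx with rfl | rfl <;> rcases hy with rfl | rfl <;> rcases hz with rfl | rfl <;>
    simp only [d1, hpq, hqp, hpp, hqq] <;> grind

lemma CocycleOn2.mono {c : X → X → X → ZMod 2} {S T : Set X} (h : CocycleOn2 c T) (hS : S ⊆ T) :
    CocycleOn2 c S :=
  fun x hx y hy z hz w hw => h x (hS hx) y (hS hy) z (hS hz) w (hS hw)

lemma CocycleOn1.mono {c : X → X → ZMod 2} {S T : Set X} (h : CocycleOn1 c T) (hS : S ⊆ T) :
    CocycleOn1 c S :=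
  fun x hx y hy z hz => h x (hS hx) y (hS hy) z (hS hz)

end Algebra

/-! ### Local equality of cochains -/

variable {X Y : Type*} [TopologicalSpace X] [TopologicalSpace Y]

/-- Two 1-cochains agree on small simplices near `x`. -/
def EqAt1 (b b' : X → X → ZMod 2) (x : X) : Prop :=
  ∀ᶠ V in (𝓝 x).smallSets, ∀ p ∈ V, ∀ q ∈ V, b p q = b' p q

/-- Two 2-cochains agree on small simplices near `x`. -/
def EqAt2 (c c' : X → X → X → ZMod 2) (x : X) : Prop :=
  ∀ᶠ V in (𝓝 x).smallSets, ∀ p ∈ V, ∀ q ∈ V, ∀ r ∈ V, c p q r = c' p q r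

/-- `c` is a 2-cocycle near `x`. -/
def CocycleAt (c : X → X → X → ZMod 2) (x : X) : Prop :=
  ∀ᶠ V in (𝓝 x).smallSets, CocycleOn2 c V

lemma eqAt1_of_mem {b b' : X → X → ZMod 2} {x : X} {V : Set X} (hV : V ∈ 𝓝 x)
    (h : ∀ p ∈ V, ∀ q ∈ V, b p q = b' p q) : EqAt1 b b' x :=
  eventually_smallSets.2 ⟨V, hV, fun _ hT p hp q hq => h p (hT hp) q (hT hq)⟩

lemma eqAt2_of_mem {c c' : X → X → X → ZMod 2} {x : X} {V : Set X} (hV : V ∈ 𝓝 x)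
    (h : ∀ p ∈ V, ∀ q ∈ V, ∀ r ∈ V, c p q r = c' p q r) : EqAt2 c c' x :=
  eventually_smallSets.2 ⟨V, hV, fun _ hT p hp q hq r hr => h p (hT hp) q (hT hq) r (hT hr)⟩

lemma cocycleAt_of_mem {c : X → X → X → ZMod 2} {x : X} {V : Set X} (hV : V ∈ 𝓝 x)
    (h : CocycleOn2 c V) : CocycleAt c x :=
  eventually_smallSets.2 ⟨V, hV, fun _ hT => h.mono hT⟩

lemma EqAt1.exists_mem {b b' : X → X → ZMod 2} {x : X} (h : EqAt1 b b' x) :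
    ∃ V ∈ 𝓝 x, ∀ p ∈ V, ∀ q ∈ V, b p q = b' p q := by
  obtain ⟨V, hV, h⟩ := eventually_smallSets.1 h
  exact ⟨V, hV, h V subset_rfl⟩

lemma EqAt2.exists_mem {c c' : X → X → X → ZMod 2} {x : X} (h : EqAt2 c c' x) :
    ∃ V ∈ 𝓝 x, ∀ p ∈ V, ∀ q ∈ V, ∀ r ∈ V, c p q r = c' p q r := by
  obtain ⟨V, hV, h⟩ := eventually_smallSets.1 h
  exact ⟨V, hV, h V subset_rfl⟩

lemma CocycleAt.exists_mem {c : X → X → X → ZMod 2} {x : X} (h : CocycleAt c x) :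
    ∃ V ∈ 𝓝 x, CocycleOn2 c V := by
  obtain ⟨V, hV, h⟩ := eventually_smallSets.1 h
  exact ⟨V, hV, h V subset_rfl⟩

lemma EqAt1.of_eq {b b' : X → X → ZMod 2} (h : b = b') (x : X) : EqAt1 b b' x := by
  subst h
  exact Eventually.of_forall fun _ _ _ _ _ => rfl

lemma EqAt2.of_eq {c c' : X → X → X → ZMod 2} (h : c = c') (x : X) : EqAt2 c c' x := by
  subst h
  exact Eventually.of_forall fun _ _ _ _ _ _ _ => rfl

lemma EqAt1.symm {b b' : X → X → ZMod 2} {x : X} (h : EqAt1 b b' x) : EqAt1 b' b x := by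
  filter_upwards [h] with V hV p hp q hq using (hV p hp q hq).symm

lemma EqAt2.symm {b b' : X → X → X → ZMod 2} {x : X} (h : EqAt2 b b' x) : EqAt2 b' b x := by
  filter_upwards [h] with V hV p hp q hq r hr using (hV p hp q hq r hr).symm

lemma EqAt1.trans {a b c : X → X → ZMod 2} {x : X} (h : EqAt1 a b x) (h' : EqAt1 b c x) :
    EqAt1 a c x := by
  filter_upwards [h, h'] with V hV hV' p hp q hq using (hV p hp q hq).trans (hV' p hp q hq)

lemma EqAt2.trans {a b c : X → X → X → ZMod 2} {x : X} (h : EqAt2 a b x) (h' : EqAt2 b c x) :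
    EqAt2 a c x := by
  filter_upwards [h, h'] with V hV hV' p hp q hq r hr using
    (hV p hp q hq r hr).trans (hV' p hp q hq r hr)

lemma EqAt1.add {a b a' b' : X → X → ZMod 2} {x : X} (h : EqAt1 a b x) (h' : EqAt1 a' b' x) :
    EqAt1 (a + a') (b + b') x := by
  filter_upwards [h, h'] with V hV hV' p hp q hq
  simp only [Pi.add_apply, hV p hp q hq, hV' p hp q hq]

lemma EqAt2.add {a b a' b' : X → X → X → ZMod 2} {x : X} (h : EqAt2 a b x)
    (h' : EqAt2 a' b' x) : EqAt2 (a + a') (b + b') x := by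
  filter_upwards [h, h'] with V hV hV' p hp q hq r hr
  simp only [Pi.add_apply, hV p hp q hq r hr, hV' p hp q hq r hr]

lemma EqAt2.sum_zero {ι : Type*} {s : Finset ι} {c : ι → X → X → X → ZMod 2} {x : X}
    (h : ∀ i ∈ s, EqAt2 (c i) 0 x) : EqAt2 (∑ i ∈ s, c i) 0 x := by
  classical
  induction s using Finset.induction_on with
  | empty => exact EqAt2.of_eq (by simp) x
  | insert a s ha ih =>
    rw [Finset.sum_insert ha]
    have := (h a (by simp)).add (ih fun i hi => h i (by simp [hi]))
    rwa [add_zero] at this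

lemma EqAt1.d1 {b b' : X → X → ZMod 2} {x : X} (h : EqAt1 b b' x) : EqAt2 (d1 b) (d1 b') x := by
  filter_upwards [h] with V hV p hp q hq r hr
  simp only [AlexSpanier.d1, hV q hq r hr, hV p hp r hr, hV p hp q hq]

lemma EqAt1.d1_zero {b : X → X → ZMod 2} {x : X} (h : EqAt1 b 0 x) :
    EqAt2 (AlexSpanier.d1 b) 0 x := by
  have := h.d1
  rwa [AlexSpanier.d1_zero] at this

lemma CocycleAt.congr {c c' : X → X → X → ZMod 2} {x : X} (h : CocycleAt c x)
    (h' : EqAt2 c c' x) : CocycleAt c' x := by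
  filter_upwards [h, h'] with V hV hV' p hp q hq r hr s hs
  rw [← hV p hp q hq r hr s hs]
  simp only [d2, hV' q hq r hr s hs, hV' p hp r hr s hs, hV' p hp q hq s hs, hV' p hp q hq r hr]

lemma CocycleAt.add {c c' : X → X → X → ZMod 2} {x : X} (h : CocycleAt c x)
    (h' : CocycleAt c' x) : CocycleAt (c + c') x := by
  filter_upwards [h, h'] with V hV hV' p hp q hq r hr s hs
  have h1 := hV p hp q hq r hr s hs
  have h2 := hV' p hp q hq r hr s hs
  simp only [d2, Pi.add_apply] at *
  grind

lemma cocycleAt_d1 (b : X → X → ZMod 2) (x : X) : CocycleAt (d1 b) x :=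
  Eventually.of_forall fun _ _ _ _ _ _ _ _ _ => d2_d1 _ _ _ _ _

lemma cocycleAt_zero (x : X) : CocycleAt (0 : X → X → X → ZMod 2) x := by
  rw [← d1_zero]
  exact cocycleAt_d1 _ _

/-- In characteristic two, `c = c'` is the same as `c + c' = 0`. -/
lemma EqAt2.add_eq_zero {c c' : X → X → X → ZMod 2} {x : X} :
    EqAt2 (c + c') 0 x ↔ EqAt2 c c' x := by
  constructor <;> intro h <;> filter_upwards [h] with V hV p hp q hq r hr <;>
    have := hV p hp q hq r hr <;> simp only [Pi.add_apply, Pi.zero_apply] at * <;> grind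

lemma EqAt1.comp {b b' : Y → Y → ZMod 2} {f : X → Y} {x : X} (hf : ContinuousAt f x)
    (h : EqAt1 b b' (f x)) : EqAt1 (pull1 f b) (pull1 f b') x := by
  obtain ⟨V, hV, h⟩ := h.exists_mem
  exact eqAt1_of_mem (hf hV) fun p hp q hq => h _ hp _ hq

lemma EqAt2.comp {b b' : Y → Y → Y → ZMod 2} {f : X → Y} {x : X} (hf : ContinuousAt f x)
    (h : EqAt2 b b' (f x)) : EqAt2 (pull2 f b) (pull2 f b') x := by
  obtain ⟨V, hV, h⟩ := h.exists_mem
  exact eqAt2_of_mem (hf hV) fun p hp q hq r hr => h _ hp _ hq _ hr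

lemma CocycleAt.comp {c : Y → Y → Y → ZMod 2} {f : X → Y} {x : X} (hf : ContinuousAt f x)
    (h : CocycleAt c (f x)) : CocycleAt (pull2 f c) x := by
  obtain ⟨V, hV, h⟩ := h.exists_mem
  exact cocycleAt_of_mem (hf hV) fun p hp q hq r hr s hs => h _ hp _ hq _ hr _ hs

lemma EqAt2.of_comp {b b' : Y → Y → Y → ZMod 2} {f : X → Y} {x : X} (hf : IsOpenMap f)
    (h : EqAt2 (pull2 f b) (pull2 f b') x) : EqAt2 b b' (f x) := by
  obtain ⟨V, hV, h⟩ := h.exists_mem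
  refine eqAt2_of_mem (hf.image_mem_nhds hV) ?_
  rintro _ ⟨p, hp, rfl⟩ _ ⟨q, hq, rfl⟩ _ ⟨r, hr, rfl⟩
  exact h p hp q hq r hr

lemma CocycleAt.of_comp {c : Y → Y → Y → ZMod 2} {f : X → Y} {x : X} (hf : IsOpenMap f)
    (h : CocycleAt (pull2 f c) x) : CocycleAt c (f x) := by
  obtain ⟨V, hV, h⟩ := h.exists_mem
  refine cocycleAt_of_mem (hf.image_mem_nhds hV) ?_
  rintro _ ⟨p, hp, rfl⟩ _ ⟨q, hq, rfl⟩ _ ⟨r, hr, rfl⟩ _ ⟨s, hs, rfl⟩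
  exact h p hp q hq r hr s hs

/-- A 1-cochain vanishing when its first argument lies outside a closed set is locally zero
outside that set. -/
lemma eqAt1_zero_of_notMem {b : X → X → ZMod 2} {K : Set X} (hK : IsClosed K)
    (hb : ∀ x ∉ K, ∀ y, b x y = 0) {x : X} (hx : x ∉ K) : EqAt1 b 0 x :=
  eqAt1_of_mem (hK.isOpen_compl.mem_nhds hx) fun p hp q _ => hb p hp q

lemma cocycleAt_of_eqAt_zero {c : X → X → X → ZMod 2} {x : X} (h : EqAt2 c 0 x) :
    CocycleAt c x := (cocycleAt_zero x).congr h.symm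

variable {X Y : Type*} [TopologicalSpace X] [TopologicalSpace Y]

/-! ### Homotopy invariance -/

lemma exists_nhds_uniform {L : Set X} (hL : IsCompact L) {F : X × I → Y} (hF : Continuous F)
    {P : Set Y → Prop} (hP : ∀ S T, S ⊆ T → P T → P S) {s : I}
    (h : ∀ x ∈ L, ∃ T ∈ 𝓝 (F (x, s)), P T) :
    ∃ J ∈ 𝓝 s, ∀ x ∈ L, ∃ V ∈ 𝓝 x, P (F '' (V ×ˢ J)) := by
  refine hL.induction_on (p := fun L => ∃ J ∈ 𝓝 s, ∀ x ∈ L, ∃ V ∈ 𝓝 x, P (F '' (V ×ˢ J)))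
    ⟨univ, univ_mem, by simp⟩ ?_ ?_ ?_
  · rintro A B hAB ⟨J, hJ, h⟩
    exact ⟨J, hJ, fun x hx => h x (hAB hx)⟩
  · rintro A B ⟨J, hJ, h⟩ ⟨J', hJ', h'⟩
    refine ⟨J ∩ J', inter_mem hJ hJ', ?_⟩
    rintro x (hx | hx)
    · obtain ⟨V, hV, hVP⟩ := h x hx
      exact ⟨V, hV, hP _ _ (image_mono (prod_mono subset_rfl inter_subset_left)) hVP⟩
    · obtain ⟨V, hV, hVP⟩ := h' x hx
      exact ⟨V, hV, hP _ _ (image_mono (prod_mono subset_rfl inter_subset_right)) hVP⟩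
  · intro x hx
    obtain ⟨T, hT, hPT⟩ := h x hx
    obtain ⟨V, J, hVo, hxV, hJo, hsJ, hVJ⟩ :=
      mem_nhds_prod_iff'.1 (hF.continuousAt.preimage_mem_nhds hT)
    refine ⟨V, mem_nhdsWithin_of_mem_nhds (hVo.mem_nhds hxV), J, hJo.mem_nhds hsJ, ?_⟩
    exact fun y hy => ⟨V, hVo.mem_nhds hy, hP _ _ (image_subset_iff.2 hVJ) hPT⟩

lemma exists_partition {L L' : Set X} (hL : IsCompact L) (hL' : IsCompact L')
    {F : X × I → Y} (hF : Continuous F) {P P' : Set Y → Prop}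
    (hP : ∀ S T, S ⊆ T → P T → P S) (hP' : ∀ S T, S ⊆ T → P' T → P' S)
    (h : ∀ x ∈ L, ∀ s, ∃ T ∈ 𝓝 (F (x, s)), P T)
    (h' : ∀ x ∈ L', ∀ s, ∃ T ∈ 𝓝 (F (x, s)), P' T) :
    ∃ t : ℕ → I, t 0 = 0 ∧ (∃ n, t n = 1) ∧ ∀ n,
      (∀ x ∈ L, ∃ V ∈ 𝓝 x, P (F '' (V ×ˢ {t n, t (n + 1)}))) ∧
      (∀ x ∈ L', ∃ V ∈ 𝓝 x, P' (F '' (V ×ˢ {t n, t (n + 1)}))) := by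
  have key : ∀ s : I, ∃ J, IsOpen J ∧ s ∈ J ∧ (∀ x ∈ L, ∃ V ∈ 𝓝 x, P (F '' (V ×ˢ J))) ∧
      (∀ x ∈ L', ∃ V ∈ 𝓝 x, P' (F '' (V ×ˢ J))) := by
    intro s
    obtain ⟨J, hJ, h1⟩ := exists_nhds_uniform hL hF hP fun x hx => h x hx s
    obtain ⟨J', hJ', h2⟩ := exists_nhds_uniform hL' hF hP' fun x hx => h' x hx s
    obtain ⟨U, hU, hUo, hsU⟩ := mem_nhds_iff.1 (inter_mem hJ hJ')
    refine ⟨U, hUo, hsU, fun x hx => ?_, fun x hx => ?_⟩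
    · obtain ⟨V, hV, hVP⟩ := h1 x hx
      exact ⟨V, hV, hP _ _ (image_mono (prod_mono subset_rfl (hU.trans inter_subset_left))) hVP⟩
    · obtain ⟨V, hV, hVP⟩ := h2 x hx
      exact ⟨V, hV, hP' _ _ (image_mono (prod_mono subset_rfl (hU.trans inter_subset_right))) hVP⟩
  choose J hJo hsJ hJ using key
  obtain ⟨t, ht0, htm, ⟨n, hn⟩, ht⟩ := exists_monotone_Icc_subset_open_cover_unitInterval hJo
    fun s _ => mem_iUnion.2 ⟨s, hsJ s⟩
  refine ⟨t, ht0, ⟨n, hn n le_rfl⟩, fun m => ?_⟩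
  obtain ⟨s, hs⟩ := ht m
  have hsub : ({t m, t (m + 1)} : Set I) ⊆ J s := by
    refine Subset.trans ?_ hs
    rintro _ (rfl | rfl)
    · exact left_mem_Icc.2 (htm (Nat.le_succ m))
    · exact right_mem_Icc.2 (htm (Nat.le_succ m))
  refine ⟨fun x hx => ?_, fun x hx => ?_⟩
  · obtain ⟨V, hV, hVP⟩ := (hJ s).1 x hx
    exact ⟨V, hV, hP _ _ (image_mono (prod_mono subset_rfl hsub)) hVP⟩
  · obtain ⟨V, hV, hVP⟩ := (hJ s).2 x hx
    exact ⟨V, hV, hP' _ _ (image_mono (prod_mono subset_rfl hsub)) hVP⟩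

/-- Homotopic maps induce cohomologous pullbacks of a 2-cocycle, near a compact set `L`. The
primitive vanishes near a compact set `L'` whose trace under the homotopy avoids the support. -/
lemma exists_primitive_of_homotopy {F : X × I → Y} (hF : Continuous F)
    {c : Y → Y → Y → ZMod 2} {L L' : Set X} (hL : IsCompact L) (hL' : IsCompact L')
    (hc : ∀ x ∈ L, ∀ t, CocycleAt c (F (x, t))) (hz : ∀ x ∈ L', ∀ t, EqAt2 c 0 (F (x, t))) :
    ∃ b : X → X → ZMod 2,
      (∀ x ∈ L, EqAt2 (pull2 (fun x => F (x, 0)) c + pull2 (fun x => F (x, 1)) c) (d1 b) x) ∧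
      ∀ x ∈ L', EqAt1 b 0 x := by
  obtain ⟨t, ht0, ⟨N, hN⟩, ht⟩ := exists_partition hL hL' hF (P := CocycleOn2 c)
    (P' := fun T => ∀ p ∈ T, ∀ q ∈ T, ∀ r ∈ T, c p q r = 0)
    (fun S T h hT => hT.mono h)
    (fun S T h hT p hp q hq r hr => hT p (h hp) q (h hq) r (h hr))
    (fun x hx s => (hc x hx s).exists_mem) (fun x hx s => (hz x hx s).exists_mem)
  rw [← hN, ← ht0]
  clear hN
  induction N with
  | zero =>
    refine ⟨0, fun x _ => EqAt2.of_eq ?_ x, fun x _ => EqAt1.of_eq rfl x⟩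
    rw [add_self2, d1_zero]
  | succ n ih =>
    obtain ⟨b, hb, hb'⟩ := ih
    set f : X → Y := fun x => F (x, t n)
    set g : X → Y := fun x => F (x, t (n + 1))
    refine ⟨b + prism f g c, fun x hx => ?_, fun x hx => ?_⟩
    · obtain ⟨V, hV, hVc⟩ := (ht n).1 x hx
      have h1 : EqAt2 (pull2 f c + pull2 g c) (d1 (prism f g c)) x :=
        eqAt2_of_mem hV fun p hp q hq r hr => d1_prism hVc
          ⟨(p, t n), by simp [hp], rfl⟩ ⟨(q, t n), by simp [hq], rfl⟩ ⟨(r, t n), by simp [hr], rfl⟩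
          ⟨(p, t (n + 1)), by simp [hp], rfl⟩ ⟨(q, t (n + 1)), by simp [hq], rfl⟩
          ⟨(r, t (n + 1)), by simp [hr], rfl⟩
      have h2 := (hb x hx).add h1
      rw [← d1_add] at h2
      refine (EqAt2.of_eq ?_ x).trans h2
      funext p q r
      simp only [Pi.add_apply]
      grind
    · obtain ⟨V, hV, hVc⟩ := (ht n).2 x hx
      have h1 : EqAt1 (prism f g c) 0 x := eqAt1_of_mem hV fun p hp q hq => by
        have e1 := hVc (f p) ⟨(p, t n), by simp [hp], rfl⟩ (f q) ⟨(q, t n), by simp [hq], rfl⟩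
          (g q) ⟨(q, t (n + 1)), by simp [hq], rfl⟩
        have e2 := hVc (f p) ⟨(p, t n), by simp [hp], rfl⟩ (g p)
          ⟨(p, t (n + 1)), by simp [hp], rfl⟩ (g q) ⟨(q, t (n + 1)), by simp [hq], rfl⟩
        simp [prism, e1, e2]
      simpa using (hb' x hx).add h1

/-- Homotopic maps induce cohomologous pullbacks of a 1-cocycle, near a compact set. -/
lemma exists_primitive_of_homotopy₁ {F : X × I → Y} (hF : Continuous F)
    {b : Y → Y → ZMod 2} {L : Set X} (hL : IsCompact L)
    (hb : ∀ x ∈ L, ∀ t, EqAt2 (d1 b) 0 (F (x, t))) :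
    ∃ h : X → ZMod 2,
      ∀ x ∈ L, EqAt1 (pull1 (fun x => F (x, 0)) b + pull1 (fun x => F (x, 1)) b) (d0 h) x := by
  obtain ⟨t, ht0, ⟨N, hN⟩, ht⟩ := exists_partition hL isCompact_empty hF (P := CocycleOn1 b)
    (P' := fun _ => True) (fun S T h hT => hT.mono h) (fun _ _ _ _ => trivial)
    (fun x hx s => (hb x hx s).exists_mem) (fun x hx => by simp at hx)
  rw [← hN, ← ht0]
  clear hN
  induction N with
  | zero =>
    refine ⟨0, fun x _ => EqAt1.of_eq ?_ x⟩
    rw [add_self1]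
    funext x y
    simp [d0]
  | succ n ih =>
    obtain ⟨h, hh⟩ := ih
    set f : X → Y := fun x => F (x, t n)
    set g : X → Y := fun x => F (x, t (n + 1))
    refine ⟨h + fun x => b (f x) (g x), fun x hx => ?_⟩
    obtain ⟨V, hV, hVc⟩ := (ht n).1 x hx
    have h1 : EqAt1 (pull1 f b + pull1 g b) (d0 fun x => b (f x) (g x)) x :=
      eqAt1_of_mem hV fun p hp q hq => d0_prism hVc
        ⟨(p, t n), by simp [hp], rfl⟩ ⟨(q, t n), by simp [hq], rfl⟩
        ⟨(p, t (n + 1)), by simp [hp], rfl⟩ ⟨(q, t (n + 1)), by simp [hq], rfl⟩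
    have h2 := (hh x hx).add h1
    rw [← d0_add] at h2
    refine (EqAt1.of_eq ?_ x).trans h2
    funext p q
    simp only [Pi.add_apply]
    grind

/-- Truncate a primitive to a closed set on whose frontier it vanishes. -/
lemma exists_truncated_primitive {c : X → X → X → ZMod 2} {b : X → X → ZMod 2} {K E : Set X}
    (hK : IsClosed K) (hfr : ∀ x ∈ frontier K, EqAt1 b 0 x)
    (h_int : ∀ x ∈ interior K, x ∉ E → EqAt2 c (d1 b) x)
    (hext : ∀ x ∉ interior K, EqAt2 c 0 x) :
    ∃ b' : X → X → ZMod 2, (∀ x ∉ K, ∀ y, b' x y = 0) ∧ ∀ x ∉ E, EqAt2 c (d1 b') x := by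
  classical
  refine ⟨fun x y => if x ∈ K ∧ y ∈ K then b x y else 0, fun x hx y => by simp [hx],
    fun x hx => ?_⟩
  by_cases hxi : x ∈ interior K
  · refine (h_int x hxi hx).trans (EqAt1.d1 ?_)
    refine eqAt1_of_mem (isOpen_interior.mem_nhds hxi) fun p hp q hq => ?_
    rw [if_pos ⟨interior_subset hp, interior_subset hq⟩]
  · refine (hext x hxi).trans (EqAt2.symm (EqAt1.d1_zero ?_))
    by_cases hxK : x ∈ K
    · obtain ⟨V, hV, hb⟩ := (hfr x ⟨subset_closure hxK, hxi⟩).exists_mem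
      refine eqAt1_of_mem hV fun p hp q hq => ?_
      split_ifs
      · exact hb p hp q hq
      · rfl
    · exact eqAt1_zero_of_notMem hK (fun p hp q => by simp [hp]) hxK

/-- A compactly supported class is invariant under homotopies whose relevant part is compact. -/
lemma exists_compact_primitive_of_homotopy [T2Space X] [LocallyCompactSpace X]
    {F : X × I → Y} (hF : Continuous F) {c : Y → Y → Y → ZMod 2} {L : Set X} (hL : IsCompact L)
    (hc : ∀ y, CocycleAt c y) (hz : ∀ x ∉ L, ∀ t, EqAt2 c 0 (F (x, t))) :
    ∃ (b : X → X → ZMod 2) (K : Set X), IsCompact K ∧ (∀ x ∉ K, ∀ y, b x y = 0) ∧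
      ∀ x, EqAt2 (pull2 (fun x => F (x, 0)) c + pull2 (fun x => F (x, 1)) c) (d1 b) x := by
  obtain ⟨K, hK, hLK⟩ := exists_compact_superset hL
  have hfrc : IsCompact (frontier K) := hK.of_isClosed_subset isClosed_frontier
    hK.isClosed.frontier_subset
  obtain ⟨b, hb, hb'⟩ := exists_primitive_of_homotopy hF hK hfrc (c := c)
    (fun x _ t => hc _) (fun x hx t => hz x (fun h => hx.2 (hLK h)) t)
  have h0 : ∀ t, Continuous fun x => F (x, t) := fun t => by fun_prop
  obtain ⟨b', h1, h2⟩ := exists_truncated_primitive (E := ∅) hK.isClosed hb'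
    (fun x hx _ => hb x (interior_subset hx)) (fun x hx => by
      have e : ∀ t, EqAt2 (pull2 (fun x => F (x, t)) c) 0 x := fun t =>
        (hz x (fun h => hx (hLK h)) t).comp (h0 t).continuousAt
      simpa using (e 0).add (e 1))
  exact ⟨b', K, hK, h1, fun x => h2 x (by simp)⟩

/-- If `r` is close to `f` and locally two-valued, then the pullback of a 2-cocycle under `f`
has an explicit primitive. -/
lemma exists_primitive_of_two_valued {Z : Type*} (f r : X → Z) (c : Z → Z → Z → ZMod 2) :
    ∃ b : X → X → ZMod 2,
      (∀ x, (∃ V ∈ 𝓝 x, ∃ T : Set Z, CocycleOn2 c T ∧ (∀ y ∈ V, f y ∈ T ∧ r y ∈ T) ∧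
        ∃ p ∈ T, ∃ q ∈ T, ∀ y ∈ V, r y = p ∨ r y = q) → EqAt2 (pull2 f c) (d1 b) x) ∧
      (∀ x, (∃ V ∈ 𝓝 x, ∃ T : Set Z, (∀ p ∈ T, ∀ q ∈ T, ∀ r ∈ T, c p q r = 0) ∧
        (∀ y ∈ V, f y ∈ T ∧ r y ∈ T)) → EqAt1 b 0 x) := by
  obtain ⟨m, hm, hm'⟩ := exists_pair_choice Z
  refine ⟨prism f r c + pull1 r (fun x y => c (m x y) x y), ?_, ?_⟩
  · rintro x ⟨V, hV, T, hT, hVT, p, hp, q, hq, hpq⟩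
    refine eqAt2_of_mem hV fun x hx y hy z hz => ?_
    have h1 := d1_prism hT (hVT x hx).1 (hVT y hy).1 (hVT z hz).1 (hVT x hx).2 (hVT y hy).2
      (hVT z hz).2
    have hc : CocycleOn2 c {p, q} := hT.mono (by rintro _ (rfl | rfl) <;> assumption)
    have h2 := d1_pair hm hm' hc (hpq x hx) (hpq y hy) (hpq z hz)
    rw [d1_add, Pi.add_apply, Pi.add_apply, Pi.add_apply, ← h1, ← pull2_d1]
    simp only [pull2]
    rw [h2]
    grind
  · rintro x ⟨V, hV, T, hT, hVT⟩
    refine eqAt1_of_mem hV fun x hx y hy => ?_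
    have h : m (r x) (r y) ∈ T := by
      rcases hm' (r x) (r y) with h | h <;> rw [h]
      exacts [(hVT x hx).2, (hVT y hy).2]
    simp [prism, pull1, hT _ h _ (hVT x hx).2 _ (hVT y hy).2,
      hT _ (hVT x hx).1 _ (hVT y hy).1 _ (hVT y hy).2,
      hT _ (hVT x hx).1 _ (hVT x hx).2 _ (hVT y hy).2]

/-! ### Triviality with compact supports -/

section Triv

variable {X : Type*} [TopologicalSpace X]

/-- `c` has a global primitive supported in `K`. -/
def BoundsIn (c : X → X → X → ZMod 2) (K : Set X) : Prop :=
  ∃ b : X → X → ZMod 2, (∀ x ∉ K, ∀ y, b x y = 0) ∧ ∀ x, EqAt2 c (d1 b) x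

/-- `c` has a compactly supported primitive. -/
def Triv (c : X → X → X → ZMod 2) : Prop := ∃ K, IsCompact K ∧ BoundsIn c K

lemma Triv.congr {c c' : X → X → X → ZMod 2} (h : Triv c) (h' : ∀ x, EqAt2 c c' x) :
    Triv c' := by
  obtain ⟨K, hK, b, hb, hcb⟩ := h
  exact ⟨K, hK, b, hb, fun x => (h' x).symm.trans (hcb x)⟩

lemma Triv.add {c c' : X → X → X → ZMod 2} (h : Triv c) (h' : Triv c') : Triv (c + c') := by
  obtain ⟨K, hK, b, hb, hcb⟩ := h
  obtain ⟨K', hK', b', hb', hcb'⟩ := h'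
  refine ⟨K ∪ K', hK.union hK', b + b', fun x hx y => ?_, fun x => ?_⟩
  · rw [mem_union, not_or] at hx
    simp [hb x hx.1, hb' x hx.2]
  · rw [d1_add]
    exact (hcb x).add (hcb' x)

lemma triv_d1 {b : X → X → ZMod 2} {K : Set X} (hK : IsCompact K)
    (hb : ∀ x ∉ K, ∀ y, b x y = 0) : Triv (d1 b) :=
  ⟨K, hK, b, hb, fun x => EqAt2.of_eq rfl x⟩

lemma triv_zero : Triv (0 : X → X → X → ZMod 2) := by
  rw [← d1_zero]
  exact triv_d1 isCompact_empty fun _ _ _ => rfl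

lemma Triv.of_add {c c' : X → X → X → ZMod 2} (h : Triv c) (h' : Triv (c + c')) : Triv c' := by
  have := h.add h'
  rwa [← add_assoc, add_self2, zero_add] at this

/-- A function with zero coboundary along a preconnected set is constant there. -/
lemma eq_of_isPreconnected {g : X → ZMod 2} {C : Set X} (hC : IsPreconnected C)
    (h : ∀ x ∈ C, EqAt1 (d0 g) 0 x) {x y : X} (hx : x ∈ C) (hy : y ∈ C) : g x = g y := by
  let : TopologicalSpace (ZMod 2) := ⊥
  have : DiscreteTopology (ZMod 2) := ⟨rfl⟩
  refine hC.constant (f := g) (fun z hz => ContinuousAt.continuousWithinAt ?_) hx hy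
  obtain ⟨V, hV, hVg⟩ := (h z hz).exists_mem
  refine (continuousAt_const (y := g z)).congr ?_
  filter_upwards [hV] with w hw
  have := hVg z (mem_of_mem_nhds hV) w hw
  simp only [d0, Pi.zero_apply] at this
  grind

end Triv

/-! ### Cohomology of compact convex sets -/

section Convex

variable {E : Type*} [NormedAddCommGroup E] [NormedSpace ℝ E]

lemma continuous_contraction (v : E) :
    Continuous fun p : E × I => v + (p.2 : ℝ) • (p.1 - v) := by fun_prop

lemma contraction_mem {Q : Set E} (hQ : Convex ℝ Q) {v x : E} (hv : v ∈ Q) (hx : x ∈ Q) (t : I) :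
    v + (t : ℝ) • (x - v) ∈ Q :=
  hQ.add_smul_sub_mem hv hx t.2

lemma exists_primitive_of_convex {Q : Set E} (hQ : IsCompact Q) (hQc : Convex ℝ Q)
    {c : E → E → E → ZMod 2} (hc : ∀ x ∈ Q, CocycleAt c x) :
    ∃ b, ∀ x ∈ Q, EqAt2 c (d1 b) x := by
  rcases Q.eq_empty_or_nonempty with rfl | ⟨v, hv⟩
  · exact ⟨0, by simp⟩
  obtain ⟨b, hb, -⟩ := exists_primitive_of_homotopy (continuous_contraction v) hQ
    isCompact_empty (c := c) (fun x hx t => hc _ (contraction_mem hQc hv hx t)) (by simp)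
  refine ⟨b + fun _ _ => c v v v, fun x hx => ?_⟩
  rw [d1_add]
  refine EqAt2.trans (EqAt2.of_eq ?_ x) ((hb x hx).add (EqAt2.of_eq rfl x))
  funext p q r
  simp only [Pi.add_apply, pull2, d1, Icc.coe_zero, Icc.coe_one, zero_smul, one_smul, add_zero,
    add_sub_cancel]
  grind

lemma exists_primitive₁_of_convex {Q : Set E} (hQ : IsCompact Q) (hQc : Convex ℝ Q)
    {b : E → E → ZMod 2} (hb : ∀ x ∈ Q, EqAt2 (d1 b) 0 x) :
    ∃ f, ∀ x ∈ Q, EqAt1 b (d0 f) x := by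
  rcases Q.eq_empty_or_nonempty with rfl | ⟨v, hv⟩
  · exact ⟨0, by simp⟩
  obtain ⟨f, hf⟩ := exists_primitive_of_homotopy₁ (continuous_contraction v) hQ
    (b := b) (fun x hx t => hb _ (contraction_mem hQc hv hx t))
  obtain ⟨V, hV, hVb⟩ := (hb v hv).exists_mem
  have hvV := mem_of_mem_nhds hV
  have h0 : b v v = 0 := by
    have := hVb v hvV v hvV v hvV
    simp only [d1, Pi.zero_apply] at this
    grind
  refine ⟨f, fun x hx => EqAt1.trans (EqAt1.of_eq ?_ x) (hf x hx)⟩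
  funext p q
  simp [pull1, h0]

/-- A 1-cocycle is a coboundary near a compact set that can be pushed into a compact convex
set. -/
lemma exists_primitive₁_of_push {A Q : Set E} (hA : IsCompact A) (hQ : IsCompact Q)
    (hQc : Convex ℝ Q) {b : E → E → ZMod 2} (hb : ∀ x ∈ Q, EqAt2 (d1 b) 0 x) {G : E × I → E}
    (hG : Continuous G) (hG0 : ∀ x, G (x, 0) = x) (hG1 : ∀ x ∈ A, G (x, 1) ∈ Q)
    (hbG : ∀ x ∈ A, ∀ t, EqAt2 (d1 b) 0 (G (x, t))) :
    ∃ f, ∀ x ∈ A, EqAt1 b (d0 f) x := by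
  obtain ⟨f, hf⟩ := exists_primitive₁_of_convex hQ hQc hb
  obtain ⟨h, hh⟩ := exists_primitive_of_homotopy₁ hG hA hbG
  refine ⟨h + f ∘ fun x => G (x, 1), fun x hx => ?_⟩
  have h1 : Continuous fun x => G (x, 1) := by fun_prop
  have h2 := (hh x hx).add ((hf _ (hG1 x hx)).comp (f := fun x => G (x, 1)) h1.continuousAt)
  rw [pull1_d0, ← d0_add] at h2
  refine EqAt1.trans (EqAt1.of_eq ?_ x) h2
  funext p q
  simp only [Pi.add_apply, pull1, hG0]
  grind

end Convex

/-! ### The point class of the plane -/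

section Plane

/-- The mod 2 winding cochain around `v`, with cut along a horizontal ray. -/
noncomputable def ang (v x y : ℝ × ℝ) : ZMod 2 :=
  open Classical in if v.1 < x.1 ∧ ¬(v.2 ≤ x.2 ↔ v.2 ≤ y.2) then 1 else 0

/-- Indicator of the closed upper half-plane through `v`. -/
noncomputable def upper (v x : ℝ × ℝ) : ZMod 2 := if v.2 ≤ x.2 then 1 else 0

/-- The point class at `v`. -/
noncomputable def pt (v : ℝ × ℝ) : ℝ × ℝ → ℝ × ℝ → ℝ × ℝ → ZMod 2 := d1 (ang v)

lemma ang_left {v x : ℝ × ℝ} (h : x.1 < v.1) : EqAt1 (ang v) 0 x := by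
  refine eqAt1_of_mem ((isOpen_lt continuous_fst continuous_const).mem_nhds h) fun p hp q _ => ?_
  have : ¬ v.1 < p.1 := not_lt.2 (le_of_lt hp)
  simp [ang, this]

lemma ang_off {v x : ℝ × ℝ} (h : x.2 ≠ v.2) : EqAt1 (ang v) 0 x := by
  rcases lt_or_gt_of_ne h with h | h
  · refine eqAt1_of_mem ((isOpen_lt continuous_snd continuous_const).mem_nhds h) fun p hp q hq => ?_
    have h1 : ¬ v.2 ≤ p.2 := not_le.2 hp
    have h2 : ¬ v.2 ≤ q.2 := not_le.2 hq
    simp [ang, h1, h2]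
  · refine eqAt1_of_mem ((isOpen_lt continuous_const continuous_snd).mem_nhds h) fun p hp q hq => ?_
    have h1 : v.2 ≤ p.2 := le_of_lt hp
    have h2 : v.2 ≤ q.2 := le_of_lt hq
    simp [ang, h1, h2]

lemma ang_right {v x : ℝ × ℝ} (h : v.1 < x.1) : EqAt1 (ang v) (d0 (upper v)) x := by
  refine eqAt1_of_mem ((isOpen_lt continuous_const continuous_fst).mem_nhds h) fun p hp q hq => ?_
  have h1 : v.1 < p.1 := hp
  by_cases h2 : v.2 ≤ p.2 <;> by_cases h3 : v.2 ≤ q.2 <;> simp [ang, d0, upper, h1, h2, h3]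
  decide

lemma pt_off {v x : ℝ × ℝ} (h : x ≠ v) : EqAt2 (pt v) 0 x := by
  rcases lt_trichotomy x.1 v.1 with h1 | h1 | h1
  · exact (ang_left h1).d1_zero
  · exact (ang_off fun h2 => h (Prod.ext h1 h2)).d1_zero
  · have := (ang_right h1).d1
    rwa [d1_d0] at this

lemma eq_of_segment {g : ℝ × ℝ → ZMod 2} {a b c d : ℝ}
    (h : ∀ x : ℝ × ℝ, x.1 ∈ Icc a b → x.2 ∈ Icc c d → EqAt1 (d0 g) 0 x) {x y : ℝ × ℝ}
    (hx : x ∈ Icc a b ×ˢ Icc c d) (hy : y ∈ Icc a b ×ˢ Icc c d) : g x = g y :=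
  eq_of_isPreconnected (isPreconnected_Icc.prod isPreconnected_Icc)
    (fun z hz => h z hz.1 hz.2) hx hy

/-- The point class is not a compactly supported coboundary. -/
lemma not_triv_pt (v : ℝ × ℝ) : ¬ Triv (pt v) := by
  rintro ⟨K, hK, b, hb, hcb⟩
  obtain ⟨R, hR⟩ := hK.isBounded.subset_closedBall v
  set r := max R 0 + 1 with hr
  have hr0 : 0 < r := by positivity
  have hd1 : ∀ x, EqAt2 (d1 (b + ang v)) 0 x := fun x => by
    rw [d1_add, EqAt2.add_eq_zero]
    exact (hcb x).symm
  obtain ⟨f, hf⟩ := exists_primitive₁_of_convex (isCompact_closedBall v r) (convex_closedBall v r)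
    fun x _ => hd1 x
  have key : ∀ x : ℝ × ℝ, max |x.1 - v.1| |x.2 - v.2| = r → EqAt1 (ang v) (d0 f) x := by
    intro x hx
    have hd : dist x v = r := by rw [Prod.dist_eq, Real.dist_eq, Real.dist_eq, hx]
    have hxK : x ∉ K := fun h => by
      have h1 := hR h
      rw [Metric.mem_closedBall, hd] at h1
      have := le_max_left R 0
      linarith
    have h1 := (eqAt1_zero_of_notMem hK.isClosed hb hxK).symm.add (EqAt1.of_eq (rfl : ang v = _) x)
    rw [zero_add] at h1
    exact h1.trans (hf x (by rw [Metric.mem_closedBall, hd]))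
  have top : f (v.1 + r, v.2 + r) = f (v.1 - r, v.2 + r) := by
    refine eq_of_segment (a := v.1 - r) (b := v.1 + r) (c := v.2 + r) (d := v.2 + r)
      (fun x h1 h2 => ?_) ⟨⟨by simp; linarith, by simp⟩, ⟨by simp, by simp⟩⟩
      ⟨⟨by simp, by simp; linarith⟩, ⟨by simp, by simp⟩⟩
    have hx2 : x.2 = v.2 + r := le_antisymm h2.2 h2.1
    refine (key x ?_).symm.trans (ang_off (by linarith))
    have e : |x.1 - v.1| ≤ r := abs_le.2 ⟨by linarith [h1.1], by linarith [h1.2]⟩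
    rw [hx2, add_sub_cancel_left, abs_of_pos hr0, max_eq_right e]
  have bot : f (v.1 + r, v.2 - r) = f (v.1 - r, v.2 - r) := by
    refine eq_of_segment (a := v.1 - r) (b := v.1 + r) (c := v.2 - r) (d := v.2 - r)
      (fun x h1 h2 => ?_) ⟨⟨by simp; linarith, by simp⟩, ⟨by simp, by simp⟩⟩
      ⟨⟨by simp, by simp; linarith⟩, ⟨by simp, by simp⟩⟩
    have hx2 : x.2 = v.2 - r := le_antisymm h2.2 h2.1
    refine (key x ?_).symm.trans (ang_off (by linarith))
    have e : |x.1 - v.1| ≤ r := abs_le.2 ⟨by linarith [h1.1], by linarith [h1.2]⟩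
    rw [hx2, sub_sub_cancel_left, abs_neg, abs_of_pos hr0, max_eq_right e]
  have left : f (v.1 - r, v.2 + r) = f (v.1 - r, v.2 - r) := by
    refine eq_of_segment (a := v.1 - r) (b := v.1 - r) (c := v.2 - r) (d := v.2 + r)
      (fun x h1 h2 => ?_) ⟨⟨by simp, by simp⟩, ⟨by simp; linarith, by simp⟩⟩
      ⟨⟨by simp, by simp⟩, ⟨by simp, by simp; linarith⟩⟩
    have hx2 : x.1 = v.1 - r := le_antisymm h1.2 h1.1
    refine (key x ?_).symm.trans (ang_left (by linarith))
    have e : |x.2 - v.2| ≤ r := abs_le.2 ⟨by linarith [h2.1], by linarith [h2.2]⟩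
    rw [hx2, sub_sub_cancel_left, abs_neg, abs_of_pos hr0, max_eq_left e]
  have right : (f + upper v) (v.1 + r, v.2 + r) = (f + upper v) (v.1 + r, v.2 - r) := by
    refine eq_of_segment (a := v.1 + r) (b := v.1 + r) (c := v.2 - r) (d := v.2 + r)
      (fun x h1 h2 => ?_) ⟨⟨by simp, by simp⟩, ⟨by simp; linarith, by simp⟩⟩
      ⟨⟨by simp, by simp⟩, ⟨by simp, by simp; linarith⟩⟩
    have hx2 : x.1 = v.1 + r := le_antisymm h1.2 h1.1
    have e : |x.2 - v.2| ≤ r := abs_le.2 ⟨by linarith [h2.1], by linarith [h2.2]⟩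
    have h3 := (key x (by
      rw [hx2, add_sub_cancel_left, abs_of_pos hr0, max_eq_left e])).symm.add
      (ang_right (x := x) (v := v) (by linarith)).symm
    rwa [add_self1, ← d0_add] at h3
  have u1 : upper v (v.1 + r, v.2 + r) = 1 := by simp [upper, hr0.le]
  have u2 : upper v (v.1 + r, v.2 - r) = 0 := by simp [upper, hr0]
  simp only [Pi.add_apply, u1, u2] at right
  rw [top, left, ← bot] at right
  simp at right

end Plane

section Annulus

/-- A half of a square annulus around `v`, on the side given by the sign `s`. -/
def halfAnnulus (v : ℝ × ℝ) (s ε R : ℝ) : Set (ℝ × ℝ) :=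
  {x | ε ≤ dist x v ∧ dist x v ≤ R ∧ 0 ≤ s * (x.2 - v.2)}

lemma dist_eq_max (x v : ℝ × ℝ) : dist x v = max |x.1 - v.1| |x.2 - v.2| := by
  rw [Prod.dist_eq, Real.dist_eq, Real.dist_eq]

lemma exists_primitive₁_of_halfAnnulus {v : ℝ × ℝ} {s ε R : ℝ} (hs : s = 1 ∨ s = -1)
    (hε : 0 < ε) (hεR : ε ≤ R) {b : ℝ × ℝ → ℝ × ℝ → ZMod 2}
    (hb : ∀ x, ε ≤ dist x v → dist x v ≤ R → EqAt2 (d1 b) 0 x) :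
    ∃ f, ∀ x ∈ halfAnnulus v s ε R, EqAt1 b (d0 f) x := by
  have hA : IsCompact (halfAnnulus v s ε R) := by
    refine (isCompact_closedBall v R).of_isClosed_subset ?_ fun x hx => hx.2.1
    have h1 : Continuous fun x : ℝ × ℝ => dist x v := by fun_prop
    have h2 : Continuous fun x : ℝ × ℝ => s * (x.2 - v.2) := by fun_prop
    exact (isClosed_le continuous_const h1).inter
      ((isClosed_le h1 continuous_const).inter (isClosed_le continuous_const h2))
  have hss : |s| = 1 := by rcases hs with rfl | rfl <;> simp
  have hs2 : s * s = 1 := by rcases hs with rfl | rfl <;> norm_num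
  refine exists_primitive₁_of_push hA
    (Q := Icc (v.1 - R) (v.1 + R) ×ˢ {v.2 + s * ε}) (isCompact_Icc.prod isCompact_singleton)
    ((convex_Icc _ _).prod (convex_singleton _)) (b := b) ?_
    (G := fun p => (p.1.1, (1 - (p.2 : ℝ)) * p.1.2 + p.2 * (v.2 + s * ε))) (by fun_prop)
    (fun x => by simp) ?_ ?_
  · rintro ⟨x1, x2⟩ ⟨h1, h2⟩
    obtain rfl : x2 = v.2 + s * ε := h2
    have e : |x1 - v.1| ≤ R := abs_le.2 ⟨by linarith [h1.1], by linarith [h1.2]⟩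
    refine hb _ ?_ ?_
    · rw [dist_eq_max]
      exact le_max_of_le_right (by simp [abs_mul, hss, abs_of_pos hε])
    · rw [dist_eq_max]
      exact max_le e (by simp [abs_mul, hss, abs_of_pos hε, hεR])
  · rintro x ⟨-, h2, -⟩
    rw [dist_eq_max] at h2
    obtain ⟨h3, h4⟩ := abs_le.1 ((le_max_left _ _).trans h2)
    exact ⟨⟨by simp; linarith, by simp; linarith⟩, by simp⟩
  · rintro x ⟨h1, h2, h3⟩ t
    rw [dist_eq_max] at h1 h2
    obtain ⟨ha, hb'⟩ := max_le_iff.1 h2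
    have h0 := t.2.1
    have h0' := t.2.2
    have e : (1 - (t : ℝ)) * x.2 + t * (v.2 + s * ε) - v.2 =
        s * ((1 - (t : ℝ)) * (s * (x.2 - v.2)) + t * ε) := by
      linear_combination (1 - (t : ℝ)) * (v.2 - x.2) * hs2
    have hx2 : s * (x.2 - v.2) = |x.2 - v.2| := by
      rw [← abs_of_nonneg h3, abs_mul, hss, one_mul]
    have e2 : |(1 - (t : ℝ)) * x.2 + t * (v.2 + s * ε) - v.2| =
        (1 - (t : ℝ)) * |x.2 - v.2| + t * ε := by
      rw [e, abs_mul, hss, one_mul, hx2, abs_of_nonneg]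
      have := abs_nonneg (x.2 - v.2)
      have : 0 ≤ 1 - (t : ℝ) := by linarith
      positivity
    refine hb _ ?_ ?_
    · rw [dist_eq_max]
      simp only [e2]
      rcases le_max_iff.1 h1 with h | h
      · exact le_max_of_le_left h
      · refine le_max_of_le_right ?_
        nlinarith
    · rw [dist_eq_max]
      simp only [e2]
      refine max_le ha ?_
      nlinarith

lemma add_ite_shift {P Q : Prop} [Decidable P] [Decidable Q] {a b c d k : ZMod 2}
    (h : a + b = k) (h' : c + d = k) (l : ZMod 2) :
    a + c + (l + k) * ((if P then 1 else 0) + (if Q then 1 else 0)) =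
      (if P then a else b + l) + (if Q then c else d + l) := by
  split_ifs <;> grind

/-- Adding a multiple of the angle cochain, a 1-cocycle near a square annulus becomes a
coboundary in its interior. -/
lemma exists_primitive₁_of_annulus {v : ℝ × ℝ} {ε R : ℝ} (hε : 0 < ε) (hεR : ε ≤ R)
    {b : ℝ × ℝ → ℝ × ℝ → ZMod 2}
    (hb : ∀ x, ε ≤ dist x v → dist x v ≤ R → EqAt2 (d1 b) 0 x) :
    ∃ (k : ZMod 2) (f : ℝ × ℝ → ZMod 2),
      ∀ x, ε < dist x v → dist x v < R → EqAt1 (b + k • ang v) (d0 f) x := by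
  obtain ⟨f, hf⟩ := exists_primitive₁_of_halfAnnulus (s := 1) (by simp) hε hεR hb
  obtain ⟨g, hg⟩ := exists_primitive₁_of_halfAnnulus (s := -1) (by simp) hε hεR hb
  have hfg : ∀ x : ℝ × ℝ, x.2 = v.2 → ε ≤ |x.1 - v.1| → |x.1 - v.1| ≤ R →
      EqAt1 (d0 (f + g)) 0 x := by
    intro x h1 h2 h3
    have e : dist x v = |x.1 - v.1| := by
      rw [dist_eq_max, h1, sub_self, abs_zero, max_eq_left (abs_nonneg _)]
    have := (hf x ⟨by rwa [e], by rwa [e], by simp [h1]⟩).symm.add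
      (hg x ⟨by rwa [e], by rwa [e], by simp [h1]⟩).symm
    rwa [add_self1, ← d0_add] at this
  set kl := (f + g) (v.1 - R, v.2) with hkl
  set kr := (f + g) (v.1 + R, v.2) with hkr
  have hl : ∀ x : ℝ × ℝ, x.2 = v.2 → x.1 ≤ v.1 - ε → v.1 - R ≤ x.1 → (f + g) x = kl := by
    intro x h1 h2 h3
    refine eq_of_segment (a := v.1 - R) (b := v.1 - ε) (c := v.2) (d := v.2)
      (fun y hy hy' => hfg y (le_antisymm hy'.2 hy'.1) ?_ ?_)
      ⟨⟨h3, h2⟩, by simp [h1]⟩ ⟨⟨le_rfl, by linarith⟩, by simp⟩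
    · exact le_abs.2 (Or.inr (by linarith [hy.2]))
    · exact abs_le.2 ⟨by linarith [hy.1], by linarith [hy.2]⟩
  have hrt : ∀ x : ℝ × ℝ, x.2 = v.2 → v.1 + ε ≤ x.1 → x.1 ≤ v.1 + R → (f + g) x = kr := by
    intro x h1 h2 h3
    refine eq_of_segment (a := v.1 + ε) (b := v.1 + R) (c := v.2) (d := v.2)
      (fun y hy hy' => hfg y (le_antisymm hy'.2 hy'.1) ?_ ?_)
      ⟨⟨h2, h3⟩, by simp [h1]⟩ ⟨⟨by simpa using hεR, by simp⟩, by simp⟩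
    · exact le_abs.2 (Or.inl (by linarith [hy.1]))
    · exact abs_le.2 ⟨by linarith [hy.1], by linarith [hy.2]⟩
  refine ⟨kl + kr, fun x => if v.2 ≤ x.2 then f x else g x + kl, fun x hx1 hx2 => ?_⟩
  rcases lt_trichotomy x.2 v.2 with h | h | h
  · obtain ⟨V, hV, hVb⟩ := (hg x ⟨hx1.le, hx2.le, by linarith⟩).exists_mem
    obtain ⟨V', hV', hVa⟩ := (ang_off h.ne).exists_mem
    refine eqAt1_of_mem (inter_mem (inter_mem hV hV')
      ((isOpen_lt continuous_snd continuous_const).mem_nhds h)) fun p hp q hq => ?_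
    have h1 : ¬ v.2 ≤ p.2 := not_le.2 hp.2
    have h2 : ¬ v.2 ≤ q.2 := not_le.2 hq.2
    have h3 := hVb p hp.1.1 q hq.1.1
    have h4 := hVa p hp.1.2 q hq.1.2
    simp only [d0, Pi.add_apply, Pi.smul_apply, h1, h2, h3, h4, if_false, Pi.zero_apply,
      smul_zero]
    grind
  · have hxf := hf x ⟨hx1.le, hx2.le, by simp [h]⟩
    have hxg := hg x ⟨hx1.le, hx2.le, by simp [h]⟩
    obtain ⟨V, hV, hVf⟩ := hxf.exists_mem
    obtain ⟨W, hW, hWg⟩ := hxg.exists_mem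
    have hxV := mem_of_mem_nhds hV
    have hxW := mem_of_mem_nhds hW
    have e : dist x v = |x.1 - v.1| := by
      rw [dist_eq_max, h, sub_self, abs_zero, max_eq_left (abs_nonneg _)]
    rw [e] at hx1 hx2
    have hcon : ∀ {k}, (f + g) x = k → ∀ p ∈ V ∩ W, f p + g p = k := by
      rintro _ rfl p ⟨hp, hp'⟩
      have h1 : b x p = f x + f p := hVf x hxV p hp
      have h2 : b x p = g x + g p := hWg x hxW p hp'
      rw [Pi.add_apply]
      grind
    obtain ⟨hx3, hx4⟩ := abs_lt.1 hx2
    rcases lt_abs.1 hx1 with h5 | h5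
    · obtain ⟨U, hU, hUa⟩ := (ang_right (v := v) (x := x) (by linarith)).exists_mem
      have hk := hrt x h (by linarith) (by linarith)
      refine eqAt1_of_mem (inter_mem (inter_mem hV hW) hU) fun p hp q hq => ?_
      have h1 : b p q = f p + f q := hVf p hp.1.1 q hq.1.1
      have h2 : f p + g p = kr := hcon hk p hp.1
      have h3 : f q + g q = kr := hcon hk q hq.1
      have h4 := hUa p hp.2 q hq.2
      simp only [d0, Pi.add_apply, Pi.smul_apply, smul_eq_mul, h1, h4, upper]
      exact add_ite_shift h2 h3 kl
    · obtain ⟨U, hU, hUa⟩ := (ang_left (v := v) (x := x) (by linarith)).exists_mem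
      have hk := hl x h (by linarith) (by linarith)
      refine eqAt1_of_mem (inter_mem (inter_mem hV hW) hU) fun p hp q hq => ?_
      have h1 : b p q = f p + f q := hVf p hp.1.1 q hq.1.1
      have h2 : f p + g p = kl := hcon hk p hp.1
      have h3 : f q + g q = kl := hcon hk q hq.1
      have h4 := hUa p hp.2 q hq.2
      simp only [d0, Pi.add_apply, Pi.smul_apply, smul_eq_mul, h1, h4, Pi.zero_apply, mul_zero,
        add_zero]
      have h5 := add_ite_shift (P := v.2 ≤ p.2) (Q := v.2 ≤ q.2) h2 h3 kl
      rwa [CharTwo.add_self_eq_zero kl, zero_mul, add_zero] at h5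
  · obtain ⟨V, hV, hVb⟩ := (hf x ⟨hx1.le, hx2.le, by linarith⟩).exists_mem
    obtain ⟨V', hV', hVa⟩ := (ang_off h.ne').exists_mem
    refine eqAt1_of_mem (inter_mem (inter_mem hV hV')
      ((isOpen_lt continuous_const continuous_snd).mem_nhds h)) fun p hp q hq => ?_
    have h1 : v.2 ≤ p.2 := le_of_lt hp.2
    have h2 : v.2 ≤ q.2 := le_of_lt hq.2
    have h3 := hVb p hp.1.1 q hq.1.1
    have h4 := hVa p hp.1.2 q hq.1.2
    simp only [d0, Pi.add_apply, Pi.smul_apply, h1, h2, h3, h4, if_true, Pi.zero_apply,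
      smul_zero, add_zero]

/-- A cocycle of the plane supported in a ball is a coboundary, up to the point class. -/
lemma boundsIn_or {v : ℝ × ℝ} {ρ R : ℝ} (hρ : 0 ≤ ρ) (hρR : ρ < R)
    {c : ℝ × ℝ → ℝ × ℝ → ℝ × ℝ → ZMod 2} (hc : ∀ x, CocycleAt c x)
    (hz : ∀ x, ρ < dist x v → EqAt2 c 0 x) :
    BoundsIn c (Metric.closedBall v R) ∨ BoundsIn (c + pt v) (Metric.closedBall v R) := by
  obtain ⟨ε, hρε, hεR⟩ := exists_between hρR
  obtain ⟨τ, hετ, hτR⟩ := exists_between hεR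
  have hε : 0 < ε := by linarith
  obtain ⟨b, hb⟩ := exists_primitive_of_convex (isCompact_closedBall v R)
    (convex_closedBall v R) fun x _ => hc x
  obtain ⟨k, f, hf⟩ := exists_primitive₁_of_annulus (v := v) hε hεR.le (b := b)
    fun x h1 h2 => (hb x h2).symm.trans (hz x (by linarith))
  have main : BoundsIn (c + k • pt v) (Metric.closedBall v R) := by
    have hsm : d1 (k • ang v) = k • pt v := by
      funext x y z
      simp only [pt, d1, Pi.smul_apply, smul_add]
    have hfr : ∀ x ∈ frontier (Metric.closedBall v τ), EqAt1 (b + k • ang v + d0 f) 0 x := by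
      intro x hx
      have hx' : dist x v = τ := Metric.frontier_closedBall_subset_sphere hx
      have := (hf x (by linarith) (by linarith)).add (EqAt1.of_eq (rfl : d0 f = _) x)
      rwa [add_self1 (d0 f)] at this
    have h_int : ∀ x ∈ interior (Metric.closedBall v τ), x ∉ (∅ : Set (ℝ × ℝ)) →
        EqAt2 (c + k • pt v) (d1 (b + k • ang v + d0 f)) x := by
      intro x hx _
      have hx' : dist x v ≤ τ := Metric.mem_closedBall.1 (interior_subset hx)
      rw [d1_add, d1_add, d1_d0, add_zero, hsm]
      exact (hb x (by rw [Metric.mem_closedBall]; linarith)).add (EqAt2.of_eq rfl x)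
    have hext : ∀ x ∉ interior (Metric.closedBall v τ), EqAt2 (c + k • pt v) 0 x := by
      intro x hx
      have hx' : τ ≤ dist x v := by
        by_contra! h
        exact hx (Metric.ball_subset_interior_closedBall h)
      have hne : x ≠ v := by
        rintro rfl
        rw [dist_self] at hx'
        linarith
      obtain ⟨U, hU, hUz⟩ := (hz x (by linarith)).exists_mem
      obtain ⟨U', hU', hUz'⟩ := (pt_off hne).exists_mem
      refine eqAt2_of_mem (inter_mem hU hU') fun p hp q hq r hr => ?_
      simp [hUz p hp.1 q hq.1 r hr.1, hUz' p hp.2 q hq.2 r hr.2]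
    obtain ⟨b', h1, h2⟩ := exists_truncated_primitive Metric.isClosed_closedBall hfr h_int hext
    exact ⟨b', fun x hx => h1 x fun h => hx (Metric.closedBall_subset_closedBall hτR.le h),
      fun x => h2 x (by simp)⟩
  obtain rfl | rfl : k = 0 ∨ k = 1 := by
    clear main hf
    revert k
    decide
  · left
    rwa [zero_smul, add_zero] at main
  · right
    rwa [one_smul] at main

lemma triv_or {K : Set (ℝ × ℝ)} (hK : IsCompact K)
    {c : ℝ × ℝ → ℝ × ℝ → ℝ × ℝ → ZMod 2} (hc : ∀ x, CocycleAt c x)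
    (hz : ∀ x ∉ K, EqAt2 c 0 x) : Triv c ∨ Triv (c + pt 0) := by
  obtain ⟨R, hR⟩ := hK.isBounded.subset_closedBall 0
  have := boundsIn_or (v := 0) (ρ := max R 0) (R := max R 0 + 1) (by simp) (by simp) hc
    (fun x hx => hz x fun h => by
      have h1 : dist x 0 ≤ R := hR h
      have h2 := le_max_left R 0
      linarith)
  exact this.imp (fun h => ⟨_, isCompact_closedBall _ _, h⟩)
    fun h => ⟨_, isCompact_closedBall _ _, h⟩

/-- A trivial cocycle supported at a point is trivial in any neighbourhood of that point. -/
lemma boundsIn_of_triv {c : ℝ × ℝ → ℝ × ℝ → ℝ × ℝ → ZMod 2} (hc : ∀ x, CocycleAt c x)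
    {v : ℝ × ℝ} (hz : ∀ x, x ≠ v → EqAt2 c 0 x) (ht : Triv c) {W : Set (ℝ × ℝ)} (hW : W ∈ 𝓝 v) :
    ∃ K ⊆ W, IsCompact K ∧ BoundsIn c K := by
  obtain ⟨R, hR, hRW⟩ := Metric.nhds_basis_closedBall.mem_iff.1 hW
  refine ⟨_, hRW, isCompact_closedBall v R, ?_⟩
  refine (boundsIn_or le_rfl hR hc fun x hx => hz x (dist_pos.1 hx)).resolve_right fun h => ?_
  exact not_triv_pt v (ht.of_add ⟨_, isCompact_closedBall v R, h⟩)

end Annulus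

/-! ### The trace -/

section Trace

/-- The class of a compactly supported 2-cocycle of the plane. -/
noncomputable def tr (c : ℝ × ℝ → ℝ × ℝ → ℝ × ℝ → ZMod 2) : ZMod 2 :=
  open Classical in if Triv c then 0 else 1

lemma tr_of_triv {c : ℝ × ℝ → ℝ × ℝ → ℝ × ℝ → ZMod 2} (h : Triv c) : tr c = 0 := if_pos h

lemma tr_congr {c c' : ℝ × ℝ → ℝ × ℝ → ℝ × ℝ → ZMod 2} (h : ∀ x, EqAt2 c c' x) :
    tr c = tr c' := by
  have : Triv c ↔ Triv c' := ⟨fun h' => h'.congr h, fun h' => h'.congr fun x => (h x).symm⟩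
  by_cases h' : Triv c
  · rw [tr_of_triv h', tr_of_triv (this.1 h')]
  · rw [tr, tr, if_neg h', if_neg (this.not.1 h')]

lemma tr_pt (v : ℝ × ℝ) : tr (pt v) = 1 := if_neg (not_triv_pt v)

lemma tr_add {K K' : Set (ℝ × ℝ)} (hK : IsCompact K) (hK' : IsCompact K')
    {c c' : ℝ × ℝ → ℝ × ℝ → ℝ × ℝ → ZMod 2} (hc : ∀ x, CocycleAt c x)
    (hz : ∀ x ∉ K, EqAt2 c 0 x) (hc' : ∀ x, CocycleAt c' x) (hz' : ∀ x ∉ K', EqAt2 c' 0 x) :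
    tr (c + c') = tr c + tr c' := by
  by_cases h : Triv c <;> by_cases h' : Triv c'
  · simp [tr, h, h', h.add h']
  · have : ¬ Triv (c + c') := fun h2 => h' (h.of_add h2)
    simp [tr, h, h', this]
  · have : ¬ Triv (c + c') := fun h2 => h (h'.of_add (by rwa [add_comm]))
    simp [tr, h, h', this]
  · have h1 := (triv_or hK hc hz).resolve_left h
    have h2 := (triv_or hK' hc' hz').resolve_left h'
    have : Triv (c + c') := by
      have h3 := h1.add h2
      rwa [add_add_add_comm, add_self2 (pt 0), add_zero] at h3
    simp only [tr, h, h', this, if_true, if_false]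
    decide

end Trace

/-! ### Grids -/

section Grid

lemma eventually_floor (u : ℝ) :
    ∀ᶠ w in 𝓝 u, (⌊w⌋ = ⌊u⌋ ∨ ⌊w⌋ = ⌊u⌋ - 1) ∧ (u ≠ ⌊u⌋ → ⌊w⌋ = ⌊u⌋) := by
  have h1 : (⌊u⌋ : ℝ) - 1 < u := by linarith [Int.floor_le u]
  have h2 : u < ⌊u⌋ + 1 := Int.lt_floor_add_one u
  by_cases hu : u = ⌊u⌋
  · filter_upwards [Ioo_mem_nhds h1 h2] with w hw
    refine ⟨?_, fun h => absurd hu h⟩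
    rcases lt_or_ge w ⌊u⌋ with h | h
    · right
      exact Int.floor_eq_iff.2 ⟨by push_cast; linarith [hw.1], by push_cast; linarith⟩
    · left
      exact Int.floor_eq_iff.2 ⟨h, hw.2⟩
  · have h3 : (⌊u⌋ : ℝ) < u := lt_of_le_of_ne (Int.floor_le u) (Ne.symm hu)
    filter_upwards [Ioo_mem_nhds h3 h2] with w hw
    have h4 : ⌊w⌋ = ⌊u⌋ := Int.floor_eq_iff.2 ⟨hw.1.le, hw.2⟩
    exact ⟨Or.inl h4, fun _ => h4⟩

/-- The lattice point with given integer coordinates. -/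
def latticePt (ε : ℝ) (z : ℤ × ℤ) : ℝ × ℝ := (ε * z.1, ε * z.2)

/-- Rounding down to the lattice. -/
noncomputable def toLattice (ε : ℝ) (x : ℝ × ℝ) : ℝ × ℝ := latticePt ε (⌊x.1 / ε⌋, ⌊x.2 / ε⌋)

lemma abs_sub_lt_of_floor {ε u : ℝ} (hε : 0 < ε) {n : ℤ} (hn : n = ⌊u / ε⌋ ∨ n = ⌊u / ε⌋ - 1) :
    |ε * n - u| ≤ 2 * ε := by
  have h1 := Int.floor_le (u / ε)
  have h2 := Int.lt_floor_add_one (u / ε)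
  have e : u = ε * (u / ε) := by field_simp
  have h : |n - u / ε| ≤ 2 := by
    rcases hn with rfl | rfl <;> push_cast <;> exact abs_le.2 ⟨by linarith, by linarith⟩
  calc |ε * n - u| = |ε * (n - u / ε)| := by rw [mul_sub, ← e]
    _ = ε * |n - u / ε| := by rw [abs_mul, abs_of_pos hε]
    _ ≤ 2 * ε := by nlinarith

lemma dist_latticePt {ε : ℝ} (hε : 0 < ε) {x : ℝ × ℝ} {z : ℤ × ℤ}
    (h1 : z.1 = ⌊x.1 / ε⌋ ∨ z.1 = ⌊x.1 / ε⌋ - 1) (h2 : z.2 = ⌊x.2 / ε⌋ ∨ z.2 = ⌊x.2 / ε⌋ - 1) :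
    dist (latticePt ε z) x ≤ 2 * ε := by
  rw [dist_eq_max]
  exact max_le (abs_sub_lt_of_floor hε h1) (abs_sub_lt_of_floor hε h2)

lemma dist_toLattice {ε : ℝ} (hε : 0 < ε) (x : ℝ × ℝ) : dist (toLattice ε x) x ≤ 2 * ε :=
  dist_latticePt hε (Or.inl rfl) (Or.inl rfl)

/-- Off the lattice, rounding to the lattice is locally two-valued. -/
lemma toLattice_two_valued {ε : ℝ} (hε : 0 < ε) {x : ℝ × ℝ} (hx : x ∉ range (latticePt ε)) :
    ∃ p q, dist p x ≤ 2 * ε ∧ dist q x ≤ 2 * ε ∧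
      ∀ᶠ y in 𝓝 x, toLattice ε y = p ∨ toLattice ε y = q := by
  have c1 : Tendsto (fun y : ℝ × ℝ => y.1 / ε) (𝓝 x) (𝓝 (x.1 / ε)) :=
    (continuous_fst.div_const ε).tendsto x
  have c2 : Tendsto (fun y : ℝ × ℝ => y.2 / ε) (𝓝 x) (𝓝 (x.2 / ε)) :=
    (continuous_snd.div_const ε).tendsto x
  have e1 := c1.eventually (eventually_floor _)
  have e2 := c2.eventually (eventually_floor _)
  by_cases h1 : x.1 / ε = ⌊x.1 / ε⌋
  · have h2 : x.2 / ε ≠ ⌊x.2 / ε⌋ := fun h2 => hx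
      ⟨(⌊x.1 / ε⌋, ⌊x.2 / ε⌋), Prod.ext (by rw [latticePt, ← h1]; field_simp)
        (by rw [latticePt, ← h2]; field_simp)⟩
    refine ⟨_, _, dist_latticePt hε (z := (⌊x.1 / ε⌋, ⌊x.2 / ε⌋)) (Or.inl rfl) (Or.inl rfl),
      dist_latticePt hε (z := (⌊x.1 / ε⌋ - 1, ⌊x.2 / ε⌋)) (Or.inr rfl) (Or.inl rfl), ?_⟩
    filter_upwards [e1, e2] with y hy1 hy2
    rcases hy1.1 with h | h
    · exact Or.inl (by rw [toLattice, h, hy2.2 h2])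
    · exact Or.inr (by rw [toLattice, h, hy2.2 h2])
  · refine ⟨_, _, dist_latticePt hε (z := (⌊x.1 / ε⌋, ⌊x.2 / ε⌋)) (Or.inl rfl) (Or.inl rfl),
      dist_latticePt hε (z := (⌊x.1 / ε⌋, ⌊x.2 / ε⌋ - 1)) (Or.inl rfl) (Or.inr rfl), ?_⟩
    filter_upwards [e1, e2] with y hy1 hy2
    rcases hy2.1 with h | h
    · exact Or.inl (by rw [toLattice, h, hy1.2 h1])
    · exact Or.inr (by rw [toLattice, h, hy1.2 h1])

lemma finite_inter_lattice {ε : ℝ} (hε : 0 < ε) {K : Set (ℝ × ℝ)} (hK : Bornology.IsBounded K) :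
    (K ∩ range (latticePt ε)).Finite := by
  obtain ⟨R, hR⟩ := hK.subset_closedBall 0
  refine (((finite_Icc ⌊-(R / ε)⌋ ⌈R / ε⌉).prod (finite_Icc ⌊-(R / ε)⌋ ⌈R / ε⌉)).image
    (latticePt ε)).subset ?_
  rintro _ ⟨hx, z, rfl⟩
  refine ⟨z, ?_, rfl⟩
  have h1 := hR hx
  rw [Metric.mem_closedBall, dist_eq_max] at h1
  have key : ∀ n : ℤ, |ε * n - 0| ≤ R → n ∈ Icc ⌊-(R / ε)⌋ ⌈R / ε⌉ := by
    intro n hn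
    rw [sub_zero, abs_mul, abs_of_pos hε, mul_comm, ← le_div_iff₀ hε] at hn
    obtain ⟨h3, h4⟩ := abs_le.1 hn
    exact ⟨by exact_mod_cast (Int.floor_le _).trans h3, by exact_mod_cast h4.trans (Int.le_ceil _)⟩
  exact ⟨key _ ((le_max_left _ _).trans h1), key _ ((le_max_right _ _).trans h1)⟩

/-- Near a compact set `K'`, a cocycle has a primitive away from finitely many points. -/
lemma exists_primitive_off_finite {c : ℝ × ℝ → ℝ × ℝ → ℝ × ℝ → ZMod 2}
    (hc : ∀ x, CocycleAt c x) {K W : Set (ℝ × ℝ)} (hK : IsCompact K) (hW : IsOpen W)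
    (hKW : K ⊆ W) (hz : ∀ x ∉ K, EqAt2 c 0 x) :
    ∃ (b : ℝ × ℝ → ℝ × ℝ → ZMod 2) (K' F : Set (ℝ × ℝ)), IsCompact K' ∧ K' ⊆ W ∧
      (∀ x ∉ K', ∀ y, b x y = 0) ∧ F.Finite ∧ F ⊆ W ∧ ∀ x ∉ F, EqAt2 c (d1 b) x := by
  obtain ⟨K', hK', hKK', hK'W⟩ := exists_compact_between hK hW hKW
  have hfr : IsCompact (frontier K') :=
    hK'.of_isClosed_subset isClosed_frontier hK'.isClosed.frontier_subset
  have leb : ∀ {L : Set (ℝ × ℝ)} {P : Set (ℝ × ℝ) → Prop}, IsCompact L →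
      (∀ S T, S ⊆ T → P T → P S) → (∀ x ∈ L, ∃ T ∈ 𝓝 x, P T) →
      ∃ δ > 0, ∀ x ∈ L, P (Metric.ball x δ) := by
    intro L P hL hP h
    have : ∀ x : L, ∃ T, IsOpen T ∧ x.1 ∈ T ∧ P T := fun x => by
      obtain ⟨T, hT, hPT⟩ := h x x.2
      obtain ⟨U, hUT, hU, hxU⟩ := mem_nhds_iff.1 hT
      exact ⟨U, hU, hxU, hP _ _ hUT hPT⟩
    choose T hTo hxT hPT using this
    obtain ⟨δ, hδ, hball⟩ := lebesgue_number_lemma_of_metric hL hTo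
      fun x hx => mem_iUnion.2 ⟨⟨x, hx⟩, hxT ⟨x, hx⟩⟩
    refine ⟨δ, hδ, fun x hx => ?_⟩
    obtain ⟨i, hi⟩ := hball x hx
    exact hP _ _ hi (hPT i)
  obtain ⟨δ₁, hδ₁, h1⟩ := leb (P := CocycleOn2 c) hK' (fun S T h hT => hT.mono h)
    fun x _ => (hc x).exists_mem
  obtain ⟨δ₂, hδ₂, h2⟩ := leb (P := fun T => ∀ p ∈ T, ∀ q ∈ T, ∀ r ∈ T, c p q r = 0) hfr
    (fun S T h hT p hp q hq r hr => hT p (h hp) q (h hq) r (h hr))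
    fun x hx => (hz x fun h => hx.2 (hKK' h)).exists_mem
  set ε := min δ₁ δ₂ / 8 with hε
  have hε0 : 0 < ε := by positivity
  have hε1 : 8 * ε ≤ δ₁ := by rw [hε]; linarith [min_le_left δ₁ δ₂]
  have hε2 : 8 * ε ≤ δ₂ := by rw [hε]; linarith [min_le_right δ₁ δ₂]
  have hr : ∀ {x y}, y ∈ Metric.ball x ε → ∀ {δ}, 8 * ε ≤ δ →
      y ∈ Metric.ball x δ ∧ toLattice ε y ∈ Metric.ball x δ := by
    intro x y hy δ hδ
    rw [Metric.mem_ball] at *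
    have h3 := dist_toLattice hε0 y
    have h4 := dist_triangle (toLattice ε y) y x
    rw [Metric.mem_ball]
    constructor <;> linarith
  obtain ⟨b, hb1, hb2⟩ := exists_primitive_of_two_valued id (toLattice ε) c
  obtain ⟨b', hb', hcb'⟩ := exists_truncated_primitive (E := K' ∩ range (latticePt ε))
    (b := b) (c := c) hK'.isClosed
    (fun x hx => hb2 x ⟨Metric.ball x ε, Metric.ball_mem_nhds x hε0, Metric.ball x δ₂, h2 x hx,
      fun y hy => hr hy hε2⟩)
    (fun x hx hxE => by
      have hxK' := interior_subset hx
      obtain ⟨p, q, hp, hq, hpq⟩ := toLattice_two_valued hε0 fun h => hxE ⟨hxK', h⟩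
      refine hb1 x ⟨_, inter_mem (Metric.ball_mem_nhds x hε0) hpq, Metric.ball x δ₁, h1 x hxK',
        fun y hy => hr hy.1 hε1, p, ?_, q, ?_, fun y hy => hy.2⟩ <;>
      · rw [Metric.mem_ball]
        linarith)
    (fun x hx => hz x fun h => hx (hKK' h))
  exact ⟨b', K', _, hK', hK'W, hb', finite_inter_lattice hε0 hK'.isBounded,
    fun x hx => hK'W hx.1, hcb'⟩

end Grid

/-! ### Transport along charts -/

section Charts

variable {S : Type*}

/-- Extension by zero of a 1-cochain along an embedding. -/
noncomputable def push (e : ℝ × ℝ → S) (b : ℝ × ℝ → ℝ × ℝ → ZMod 2) (x y : S) : ZMod 2 :=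
  open Classical in
  if x ∈ range e ∧ y ∈ range e then b (Function.invFun e x) (Function.invFun e y) else 0

lemma pull1_push {e : ℝ × ℝ → S} (he : Function.Injective e) (b : ℝ × ℝ → ℝ × ℝ → ZMod 2) :
    pull1 e (push e b) = b := by
  funext x y
  simp [pull1, push, Function.leftInverse_invFun he _]

lemma push_eq_zero {e : ℝ × ℝ → S} (he : Function.Injective e) {b : ℝ × ℝ → ℝ × ℝ → ZMod 2}
    {K : Set (ℝ × ℝ)} (hb : ∀ x ∉ K, ∀ y, b x y = 0) : ∀ x ∉ e '' K, ∀ y, push e b x y = 0 := by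
  intro x hx y
  simp only [push]
  split_ifs with h
  · obtain ⟨⟨u, rfl⟩, -⟩ := h
    rw [Function.leftInverse_invFun he]
    exact hb u (fun hu => hx ⟨u, hu, rfl⟩) _
  · rfl

variable [TopologicalSpace S]

lemma isCompact_preimage_of_subset_range {e : ℝ × ℝ → S} (he : IsOpenEmbedding e) {K : Set S}
    (hK : IsCompact K) (hKe : K ⊆ range e) : IsCompact (e ⁻¹' K) :=
  he.isInducing.isCompact_preimage' hK hKe

/-- A primitive in a chart of a 2-cochain supported in that chart, away from a set `F`, extends
by zero. -/
lemma eqAt2_push [T2Space S] {e : ℝ × ℝ → S} (he : IsOpenEmbedding e) {c : S → S → S → ZMod 2}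
    {b : ℝ × ℝ → ℝ × ℝ → ZMod 2} {K F : Set (ℝ × ℝ)} (hK : IsCompact K)
    (hb : ∀ x ∉ K, ∀ y, b x y = 0) (hc : ∀ x ∉ range e, EqAt2 c 0 x)
    (hcb : ∀ u ∉ F, EqAt2 (pull2 e c) (d1 b) u) :
    ∀ x ∉ e '' F, EqAt2 c (d1 (push e b)) x := by
  intro x hx
  by_cases hxe : x ∈ range e
  · obtain ⟨u, rfl⟩ := hxe
    refine EqAt2.of_comp he.isOpenMap ?_
    rw [pull2_d1, pull1_push he.injective]
    exact hcb u fun hu => hx ⟨u, hu, rfl⟩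
  · refine (hc x hxe).trans (EqAt1.d1_zero ?_).symm
    exact eqAt1_zero_of_notMem (hK.image he.continuous).isClosed (push_eq_zero he.injective hb)
      fun ⟨u, _, hu⟩ => hxe ⟨u, hu⟩

lemma BoundsIn.push [T2Space S] {e : ℝ × ℝ → S} (he : IsOpenEmbedding e) {c : S → S → S → ZMod 2}
    {K : Set (ℝ × ℝ)} (hK : IsCompact K) (hc : ∀ x ∉ range e, EqAt2 c 0 x)
    (h : BoundsIn (pull2 e c) K) : BoundsIn c (e '' K) := by
  obtain ⟨b, hb, hcb⟩ := h
  exact ⟨AlexSpanier.push e b, push_eq_zero he.injective hb, fun x =>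
    eqAt2_push (F := ∅) he hK hb hc (fun u _ => hcb u) x (by simp)⟩

lemma BoundsIn.triv_pull {e : ℝ × ℝ → S} (he : IsOpenEmbedding e) {c : S → S → S → ZMod 2}
    {K : Set S} (hK : IsCompact K) (hKe : K ⊆ range e) (h : BoundsIn c K) :
    Triv (pull2 e c) := by
  obtain ⟨b, hb, hcb⟩ := h
  exact ⟨e ⁻¹' K, isCompact_preimage_of_subset_range he hK hKe, pull1 e b,
    fun x hx y => hb _ hx _, fun x => (hcb (e x)).comp he.continuous.continuousAt⟩

/-- Extension by zero of a compactly supported cocycle along an open embedding. -/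
lemma exists_extension [T2Space S] {e : ℝ × ℝ → S} (he : IsOpenEmbedding e)
    {c : ℝ × ℝ → ℝ × ℝ → ℝ × ℝ → ZMod 2} (hc : ∀ x, CocycleAt c x) {K : Set (ℝ × ℝ)}
    (hK : IsCompact K) (hz : ∀ x ∉ K, EqAt2 c 0 x) :
    ∃ c' : S → S → S → ZMod 2, (∀ x, CocycleAt c' x) ∧ (∀ u, EqAt2 (pull2 e c') c u) ∧
      ∀ x ∉ e '' K, EqAt2 c' 0 x := by
  classical
  obtain ⟨N, hN, hKN⟩ := exists_compact_superset hK
  set i := Function.invFun e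
  have hi : ∀ u, i (e u) = u := Function.leftInverse_invFun he.injective
  set c' : S → S → S → ZMod 2 := fun x y z =>
    if x ∈ e '' N ∧ y ∈ range e ∧ z ∈ range e then c (i x) (i y) (i z) else 0 with hc'
  have hpull : ∀ u, EqAt2 (pull2 e c') c u := by
    intro u
    by_cases hu : u ∈ interior N
    · refine eqAt2_of_mem (isOpen_interior.mem_nhds hu) fun p hp q _ r _ => ?_
      simp only [pull2, hc', hi, mem_range_self, and_true]
      exact if_pos ⟨p, interior_subset hp, rfl⟩
    · have hu0 := hz u fun h => hu (hKN h)
      refine EqAt2.trans ?_ hu0.symm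
      obtain ⟨V, hV, hVc⟩ := hu0.exists_mem
      refine eqAt2_of_mem hV fun p hp q hq r hr => ?_
      simp only [pull2, hc', hi]
      split_ifs
      · exact hVc p hp q hq r hr
      · rfl
  have hoff : ∀ x ∉ e '' K, EqAt2 c' 0 x := by
    intro x hx
    by_cases hxe : x ∈ range e
    · obtain ⟨u, rfl⟩ := hxe
      refine EqAt2.of_comp he.isOpenMap ((hpull u).trans ?_)
      exact hz u fun hu => hx ⟨u, hu, rfl⟩
    · have hxN : x ∉ e '' N := fun ⟨u, _, hu⟩ => hxe ⟨u, hu⟩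
      refine eqAt2_of_mem ((hN.image he.continuous).isClosed.isOpen_compl.mem_nhds hxN)
        fun p hp q _ r _ => ?_
      exact if_neg fun h => hp h.1
  refine ⟨c', fun x => ?_, hpull, hoff⟩
  by_cases hx : x ∈ e '' K
  · obtain ⟨u, -, rfl⟩ := hx
    exact CocycleAt.of_comp he.isOpenMap ((hc u).congr (hpull u).symm)
  · exact cocycleAt_of_eqAt_zero (hoff x hx)

/-- Triviality of a cocycle supported at a point does not depend on the chart. -/
lemma triv_pull_of_triv_pull [T2Space S] {e e' : ℝ × ℝ → S} (he : IsOpenEmbedding e)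
    (he' : IsOpenEmbedding e') {c : S → S → S → ZMod 2} (hc : ∀ x, CocycleAt c x) {p : S}
    (hp : p ∈ range e) (hp' : p ∈ range e') (hz : ∀ x, x ≠ p → EqAt2 c 0 x)
    (h : Triv (pull2 e c)) : Triv (pull2 e' c) := by
  obtain ⟨v, rfl⟩ := hp
  obtain ⟨K, hKW, hK, hb⟩ := boundsIn_of_triv
    (fun x => (hc (e x)).comp he.continuous.continuousAt) (v := v)
    (fun x hx => (hz (e x) (he.injective.ne hx)).comp he.continuous.continuousAt) h
    (W := e ⁻¹' range e') ((he'.isOpen_range.preimage he.continuous).mem_nhds hp')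
  refine BoundsIn.triv_pull he' (hK.image he.continuous) (image_subset_iff.2 hKW) ?_
  exact hb.push he hK fun x hx => hz x fun h => hx ⟨v, h.symm⟩

lemma tr_pull_eq [T2Space S] {e e' : ℝ × ℝ → S} (he : IsOpenEmbedding e)
    (he' : IsOpenEmbedding e') {c : S → S → S → ZMod 2} (hc : ∀ x, CocycleAt c x) {p : S}
    (hp : p ∈ range e) (hp' : p ∈ range e') (hz : ∀ x, x ≠ p → EqAt2 c 0 x) :
    tr (pull2 e c) = tr (pull2 e' c) := by
  by_cases h : Triv (pull2 e c)
  · rw [tr_of_triv h, tr_of_triv (triv_pull_of_triv_pull he he' hc hp hp' hz h)]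
  · have h' : ¬ Triv (pull2 e' c) := fun h' => h (triv_pull_of_triv_pull he' he hc hp' hp hz h')
    rw [tr, tr, if_neg h, if_neg h']

/-- A cocycle supported on a finite set splits into cocycles supported at points. -/
lemma exists_point_decomposition [T2Space S] {c : S → S → S → ZMod 2} (hc : ∀ x, CocycleAt c x)
    {F : Finset S} (hz : ∀ x ∉ F, EqAt2 c 0 x) :
    ∃ D : S → S → S → S → ZMod 2, (∀ p x, CocycleAt (D p) x) ∧
      (∀ p x, x ≠ p → EqAt2 (D p) 0 x) ∧ ∀ x, EqAt2 c (∑ p ∈ F, D p) x := by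
  classical
  obtain ⟨U, hU, hdisj⟩ := F.finite_toSet.t2_separation
  set D : S → S → S → S → ZMod 2 := fun p x y z =>
    if p ∈ F ∧ x ∈ U p ∧ y ∈ U p ∧ z ∈ U p then c x y z else 0 with hD
  have hoff : ∀ p x, x ≠ p → EqAt2 (D p) 0 x := by
    intro p x hxp
    by_cases hp : p ∈ F
    · by_cases hx : x ∈ F
      · refine eqAt2_of_mem ((hU x).2.mem_nhds (hU x).1) fun a ha b _ d _ => if_neg fun h => ?_
        exact disjoint_left.1 (hdisj hx hp hxp) ha h.2.1
      · obtain ⟨V, hV, hVc⟩ := (hz x hx).exists_mem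
        refine eqAt2_of_mem hV fun a ha b hb d hd => ?_
        simp only [hD]
        split_ifs
        · exact hVc a ha b hb d hd
        · rfl
    · exact EqAt2.of_eq (by funext a b d; exact if_neg fun h => hp h.1) x
  have hon : ∀ p ∈ F, EqAt2 (D p) c p := fun p hp =>
    eqAt2_of_mem ((hU p).2.mem_nhds (hU p).1) fun a ha b hb d hd => if_pos ⟨hp, ha, hb, hd⟩
  refine ⟨D, fun p x => ?_, hoff, fun x => ?_⟩
  · by_cases h : x = p
    · subst h
      by_cases hp : x ∈ F
      · exact (hc x).congr (hon x hp).symm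
      · refine cocycleAt_of_eqAt_zero (EqAt2.of_eq ?_ x)
        funext a b d
        exact if_neg fun h => hp h.1
    · exact cocycleAt_of_eqAt_zero (hoff p x h)
  · by_cases hx : x ∈ F
    · rw [← Finset.add_sum_erase F D hx]
      have h1 := (hon x hx).symm.add (EqAt2.sum_zero (s := F.erase x) (c := D) (x := x)
        fun p hp => hoff p x (Finset.ne_of_mem_erase hp).symm).symm
      rwa [add_zero] at h1
    · exact (hz x hx).trans
        (EqAt2.sum_zero fun p hp => hoff p x fun h => hx (h ▸ hp)).symm

/-- A compactly supported 1-cochain splits along a finite open cover. -/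
lemma exists_cochain_partition [T2Space S] {ι : Type*} {s : Finset ι} {U : ι → Set S}
    (hU : ∀ i, IsOpen (U i)) {L : Set S} (hL : IsCompact L) (hLU : L ⊆ ⋃ i ∈ s, U i)
    {b : S → S → ZMod 2} (hb : ∀ x ∉ L, ∀ y, b x y = 0) :
    ∃ (β : ι → S → S → ZMod 2) (K : ι → Set S), (∀ i, IsCompact (K i)) ∧ (∀ i, K i ⊆ U i) ∧
      (∀ i, ∀ x ∉ K i, ∀ y, β i x y = 0) ∧ b = ∑ i ∈ s, β i := by
  classical
  obtain ⟨K, hK, hKU, hLK⟩ := hL.finite_compact_cover s U (fun i _ => hU i) hLU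
  have : ∀ x, ∃ i : Option ι, x ∈ L → ∃ j ∈ s, i = some j ∧ x ∈ K j := by
    intro x
    by_cases hx : x ∈ L
    · rw [hLK] at hx
      obtain ⟨j, hj, hxj⟩ := mem_iUnion₂.1 hx
      exact ⟨some j, fun _ => ⟨j, hj, rfl, hxj⟩⟩
    · exact ⟨none, fun h => absurd h hx⟩
  choose i hi using this
  refine ⟨fun k x y => if x ∈ L ∧ i x = some k then b x y else 0, K, hK, hKU, ?_, ?_⟩
  · intro k x hx y
    refine if_neg ?_
    rintro ⟨hxL, hik⟩
    obtain ⟨j, -, hj, hxj⟩ := hi x hxL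
    rw [hj, Option.some_inj] at hik
    exact hx (hik ▸ hxj)
  · funext x y
    simp only [Finset.sum_apply]
    by_cases hx : x ∈ L
    · obtain ⟨j, hjs, hj, -⟩ := hi x hx
      simp [hx, hj, hjs]
    · simp [hx, hb x hx]

end Charts

/-! ### The trace theorem -/

section TraceTheorem

variable {S : Type*} [TopologicalSpace S]

/-- `c` is a cocycle with compact support inside the chart `e`. -/
def SuppIn (e : ℝ × ℝ → S) (c : S → S → S → ZMod 2) : Prop :=
  (∀ x, CocycleAt c x) ∧ ∃ K ⊆ range e, IsCompact K ∧ ∀ x ∉ K, EqAt2 c 0 x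

lemma SuppIn.add {e : ℝ × ℝ → S} {c c' : S → S → S → ZMod 2} (h : SuppIn e c)
    (h' : SuppIn e c') : SuppIn e (c + c') := by
  obtain ⟨hc, K, hKe, hK, hz⟩ := h
  obtain ⟨hc', K', hKe', hK', hz'⟩ := h'
  refine ⟨fun x => (hc x).add (hc' x), K ∪ K', union_subset hKe hKe', hK.union hK',
    fun x hx => ?_⟩
  rw [mem_union, not_or] at hx
  have := (hz x hx.1).add (hz' x hx.2)
  rwa [add_zero] at this

lemma suppIn_zero (e : ℝ × ℝ → S) : SuppIn e (0 : S → S → S → ZMod 2) :=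
  ⟨cocycleAt_zero, ∅, empty_subset _, isCompact_empty, fun x _ => EqAt2.of_eq rfl x⟩

lemma suppIn_sum {e : ℝ × ℝ → S} {α : Type*} {s : Finset α} {c : α → S → S → S → ZMod 2}
    (h : ∀ a ∈ s, SuppIn e (c a)) : SuppIn e (∑ a ∈ s, c a) := by
  classical
  induction s using Finset.induction_on with
  | empty => simpa using suppIn_zero e
  | insert a s ha ih =>
    rw [Finset.sum_insert ha]
    exact (h a (by simp)).add (ih fun i hi => h i (by simp [hi]))

lemma suppIn_d1 [T2Space S] {e : ℝ × ℝ → S} {b : S → S → ZMod 2} {K : Set S} (hK : IsCompact K)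
    (hKe : K ⊆ range e) (hb : ∀ x ∉ K, ∀ y, b x y = 0) : SuppIn e (d1 b) :=
  ⟨cocycleAt_d1 b, K, hKe, hK, fun _ hx => (eqAt1_zero_of_notMem hK.isClosed hb hx).d1_zero⟩

lemma suppIn_of_point {e : ℝ × ℝ → S} {c : S → S → S → ZMod 2} (hc : ∀ x, CocycleAt c x) {p : S}
    (hp : p ∈ range e) (hz : ∀ x, x ≠ p → EqAt2 c 0 x) : SuppIn e c :=
  ⟨hc, {p}, by simpa using hp, isCompact_singleton, fun x hx => hz x hx⟩

lemma tr_pull_add {e : ℝ × ℝ → S} (he : IsOpenEmbedding e) {c c' : S → S → S → ZMod 2}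
    (h : SuppIn e c) (h' : SuppIn e c') :
    tr (pull2 e (c + c')) = tr (pull2 e c) + tr (pull2 e c') := by
  obtain ⟨hc, K, hKe, hK, hz⟩ := h
  obtain ⟨hc', K', hKe', hK', hz'⟩ := h'
  have hcont := fun u => he.continuous.continuousAt (x := u)
  exact tr_add (isCompact_preimage_of_subset_range he hK hKe)
    (isCompact_preimage_of_subset_range he hK' hKe') (fun x => (hc _).comp (hcont x))
    (fun x hx => (hz _ hx).comp (hcont x)) (fun x => (hc' _).comp (hcont x))
    (fun x hx => (hz' _ hx).comp (hcont x))

lemma tr_pull_congr {e : ℝ × ℝ → S} (he : IsOpenEmbedding e) {c c' : S → S → S → ZMod 2}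
    (h : ∀ x, EqAt2 c c' x) : tr (pull2 e c) = tr (pull2 e c') :=
  tr_congr fun x => (h (e x)).comp he.continuous.continuousAt

lemma tr_pull_zero {S : Type*} (e : ℝ × ℝ → S) : tr (pull2 e (0 : S → S → S → ZMod 2)) = 0 :=
  tr_of_triv triv_zero

lemma tr_pull_sum {e : ℝ × ℝ → S} (he : IsOpenEmbedding e) {α : Type*} {s : Finset α}
    {c : α → S → S → S → ZMod 2} (h : ∀ a ∈ s, SuppIn e (c a)) :
    tr (pull2 e (∑ a ∈ s, c a)) = ∑ a ∈ s, tr (pull2 e (c a)) := by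
  classical
  induction s using Finset.induction_on with
  | empty => simpa using tr_pull_zero e
  | insert a s ha ih =>
    rw [Finset.sum_insert ha, Finset.sum_insert ha, tr_pull_add he (h a (by simp))
      (suppIn_sum fun i hi => h i (by simp [hi])), ih fun i hi => h i (by simp [hi])]

lemma tr_pull_d1 [T2Space S] {e : ℝ × ℝ → S} (he : IsOpenEmbedding e) {b : S → S → ZMod 2}
    {K : Set S}
    (hK : IsCompact K) (hKe : K ⊆ range e) (hb : ∀ x ∉ K, ∀ y, b x y = 0) :
    tr (pull2 e (d1 b)) = 0 :=
  tr_of_triv (BoundsIn.triv_pull he hK hKe ⟨b, hb, fun x => EqAt2.of_eq rfl x⟩)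

lemma eqAt2_zero_of_add {c c' : S → S → S → ZMod 2} {x : S} (h : EqAt2 (c + c') 0 x)
    (h' : EqAt2 c' 0 x) : EqAt2 c 0 x :=
  (EqAt2.add_eq_zero.1 h).trans h'

/-- Cocycles supported in charts and summing to zero have total trace zero. -/
theorem sum_tr_eq_zero [T2Space S] {ι : Type*} {e : ι → ℝ × ℝ → S}
    (he : ∀ i, IsOpenEmbedding (e i))
    (s : Finset ι) (c : ι → S → S → S → ZMod 2) (hc : ∀ i ∈ s, SuppIn (e i) (c i))
    (hsum : ∀ x, EqAt2 (∑ i ∈ s, c i) 0 x) : ∑ i ∈ s, tr (pull2 (e i) (c i)) = 0 := by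
  classical
  induction s using Finset.induction_on generalizing c with
  | empty => simp
  | insert n s hn ih =>
    obtain ⟨hcn, Kn, hKne, hKn, hzn⟩ := hc n (by simp)
    have hs : ∀ i ∈ s, SuppIn (e i) (c i) := fun i hi => hc i (by simp [hi])
    have hK : ∀ i, ∃ K ⊆ range (e i), IsCompact K ∧ (i ∈ s → ∀ x ∉ K, EqAt2 (c i) 0 x) := by
      intro i
      by_cases hi : i ∈ s
      · obtain ⟨-, K, h1, h2, h3⟩ := hs i hi
        exact ⟨K, h1, h2, fun _ => h3⟩
      · exact ⟨∅, empty_subset _, isCompact_empty, fun h => absurd h hi⟩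
    choose K hKe hK hzK using hK
    rw [Finset.sum_insert hn] at hsum
    set K' : Set S := Kn ∩ ⋃ i ∈ s, K i with hK'
    have hK'c : IsCompact K' := hKn.inter_right (s.isCompact_biUnion fun i _ => hK i).isClosed
    have hzK' : ∀ x ∉ K', EqAt2 (c n) 0 x := by
      intro x hx
      by_cases hxn : x ∈ Kn
      · refine eqAt2_zero_of_add (hsum x) (EqAt2.sum_zero fun i hi => hzK i hi x fun h => hx ?_)
        exact ⟨hxn, mem_iUnion₂.2 ⟨i, hi, h⟩⟩
      · exact hzn x hxn
    have hcont := fun u => (he n).continuous.continuousAt (x := u)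
    obtain ⟨b, L, F, hL, hLW, hbL, hF, hFW, hbF⟩ := exists_primitive_off_finite
      (c := pull2 (e n) (c n)) (K := e n ⁻¹' K') (W := e n ⁻¹' ⋃ i ∈ s, range (e i))
      (fun x => (hcn _).comp (hcont x))
      (isCompact_preimage_of_subset_range (he n) hK'c (inter_subset_left.trans hKne))
      ((isOpen_biUnion fun i _ => (he i).isOpen_range).preimage (he n).continuous)
      (preimage_mono (inter_subset_right.trans (iUnion₂_mono fun i _ => hKe i)))
      (fun x hx => (hzK' _ hx).comp (hcont x))
    have hbL' := push_eq_zero (he n).injective hbL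
    have hLc : IsCompact (e n '' L) := hL.image (he n).continuous
    have hD : ∀ x, CocycleAt (c n + d1 (push (e n) b)) x :=
      fun x => (hcn x).add (cocycleAt_d1 _ x)
    obtain ⟨D, hDc, hDz, hDs⟩ := exists_point_decomposition hD (F := (hF.image (e n)).toFinset)
      fun x hx => EqAt2.add_eq_zero.2 <| eqAt2_push (he n) hL hbL
        (fun x hx => hzK' x fun h => hx (hKne h.1)) hbF x (by simpa using hx)
    set G := (hF.image (e n)).toFinset with hG
    have hGn : ∀ p ∈ G, p ∈ range (e n) := fun p hp => by
      obtain ⟨u, -, rfl⟩ : p ∈ e n '' F := by simpa [hG] using hp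
      exact mem_range_self u
    have hGs : ∀ p, ∃ i, p ∈ G → i ∈ s ∧ p ∈ range (e i) := fun p => by
      by_cases hp : p ∈ G
      · obtain ⟨u, hu, rfl⟩ : p ∈ e n '' F := by simpa [hG] using hp
        obtain ⟨i, hi, hui⟩ := mem_iUnion₂.1 (hFW hu)
        exact ⟨i, fun _ => ⟨hi, hui⟩⟩
      · exact ⟨n, fun h => absurd h hp⟩
    choose j hj using hGs
    obtain ⟨β, M, hM, hMe, hβ, hbβ⟩ := exists_cochain_partition
      (U := fun i => range (e i)) (fun i => (he i).isOpen_range) hLc (image_subset_iff.2 hLW) hbL'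
    have hDn : ∀ p ∈ G, SuppIn (e n) (D p) := fun p hp =>
      suppIn_of_point (hDc p) (hGn p hp) (hDz p)
    have hfib : ∀ i, ∀ p ∈ G.filter (j · = i), SuppIn (e i) (D p) := by
      intro i p hp
      obtain ⟨hpG, rfl⟩ := Finset.mem_filter.1 hp
      exact suppIn_of_point (hDc p) (hj p hpG).2 (hDz p)
    have hdβ : ∀ i, SuppIn (e i) (d1 (β i)) := fun i => suppIn_d1 (hM i) (hMe i) (hβ i)
    have hmain := ih (fun i => c i + d1 (β i) + ∑ p ∈ G with j p = i, D p)
      (fun i hi => ((hs i hi).add (hdβ i)).add (suppIn_sum (hfib i))) ?_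
    · have h1 : tr (pull2 (e n) (c n)) = ∑ p ∈ G, tr (pull2 (e (j p)) (D p)) := by
        have hd := suppIn_d1 hLc (image_subset_range _ _) hbL'
        have h2 := tr_pull_add (he n) (hc n (by simp)) hd
        rw [tr_pull_d1 (he n) hLc (image_subset_range _ _) hbL', add_zero,
          tr_pull_congr (he n) hDs, tr_pull_sum (he n) hDn] at h2
        rw [← h2]
        exact Finset.sum_congr rfl fun p hp =>
          tr_pull_eq (he n) (he (j p)) (hDc p) (hGn p hp) (hj p hp).2 (hDz p)
      have h2 : ∀ i ∈ s, tr (pull2 (e i) (c i + d1 (β i) + ∑ p ∈ G with j p = i, D p)) =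
          tr (pull2 (e i) (c i)) + ∑ p ∈ G with j p = i, tr (pull2 (e (j p)) (D p)) := by
        intro i hi
        rw [tr_pull_add (he i) ((hs i hi).add (hdβ i)) (suppIn_sum (hfib i)),
          tr_pull_add (he i) (hs i hi) (hdβ i), tr_pull_d1 (he i) (hM i) (hMe i) (hβ i), add_zero,
          tr_pull_sum (he i) (hfib i)]
        congr 1
        refine Finset.sum_congr rfl fun p hp => ?_
        rw [(Finset.mem_filter.1 hp).2]
      rw [Finset.sum_congr rfl h2, Finset.sum_add_distrib,
        Finset.sum_fiberwise_of_maps_to fun p hp => (hj p hp).1] at hmain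
      rw [Finset.sum_insert hn, h1, add_comm]
      exact hmain
    · intro x
      rw [Finset.sum_add_distrib, Finset.sum_add_distrib,
        Finset.sum_fiberwise_of_maps_to fun p hp => (hj p hp).1, ← d1_sum, ← hbβ]
      have h3 := ((EqAt2.of_eq (rfl : (∑ i ∈ s, c i) + d1 (push (e n) b) = _) x).add
        (hDs x).symm).trans (EqAt2.of_eq (?_ : _ = c n + ∑ i ∈ s, c i) x)
      · exact h3.trans (hsum x)
      · rw [add_comm (c n), add_assoc, ← add_assoc (d1 _), add_self2, zero_add, add_comm]

/-- A cocycle supported in a chart which is a compactly supported coboundary has trace zero. -/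
theorem tr_pull_eq_zero_of_triv [T2Space S] {ι : Type*} {e : ι → ℝ × ℝ → S}
    (he : ∀ i, IsOpenEmbedding (e i)) (hcov : ∀ x, ∃ i, x ∈ range (e i)) {i₀ : ι}
    {c : S → S → S → ZMod 2} (hc : SuppIn (e i₀) c) (ht : Triv c) :
    tr (pull2 (e i₀) c) = 0 := by
  classical
  obtain ⟨K, hK, b, hb, hcb⟩ := ht
  obtain ⟨t, ht⟩ := hK.elim_finite_subcover (fun i => range (e i))
    (fun i => (he i).isOpen_range) fun x _ => mem_iUnion.2 (hcov x)
  obtain ⟨β, M, hM, hMe, hβ, hbβ⟩ := exists_cochain_partition (s := insert i₀ t)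
    (U := fun i => range (e i)) (fun i => (he i).isOpen_range) hK
    (ht.trans (biUnion_subset_biUnion_left fun i hi => Finset.mem_insert_of_mem hi)) hb
  have hdβ : ∀ i, SuppIn (e i) (d1 (β i)) := fun i => suppIn_d1 (hM i) (hMe i) (hβ i)
  have hci : ∀ i, SuppIn (e i) (if i = i₀ then c else 0) := fun i => by
    split_ifs with h
    · rwa [h]
    · exact suppIn_zero _
  have h1 := sum_tr_eq_zero he (insert i₀ t) (fun i => d1 (β i) + if i = i₀ then c else 0)
    (fun i _ => (hdβ i).add (hci i)) fun x => by
      rw [Finset.sum_add_distrib, ← d1_sum, ← hbβ, Finset.sum_ite_eq']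
      simpa using EqAt2.add_eq_zero.2 (hcb x).symm
  have h2 : ∀ i, tr (pull2 (e i) (d1 (β i) + if i = i₀ then c else 0)) =
      if i = i₀ then tr (pull2 (e i₀) c) else 0 := fun i => by
    rw [tr_pull_add (he i) (hdβ i) (hci i), tr_pull_d1 (he i) (hM i) (hMe i) (hβ i), zero_add]
    split_ifs with h
    · rw [h]
    · exact tr_pull_zero _
  simpa [h2] using h1

end TraceTheorem

/-! ### Locally two-valued approximations of the identity of a graph -/

lemma exists_locally_two_valued_interval {δ : ℝ} (hδ : 0 < δ) : ∃ ρ : I → I,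
    (∀ t, dist (ρ t) t < δ) ∧
    (∀ t₀, ∃ a b, dist a t₀ < δ ∧ dist b t₀ < δ ∧ ∀ᶠ t in 𝓝 t₀, ρ t = a ∨ ρ t = b) ∧
    (∀ᶠ t in 𝓝 0, ρ t = 0) ∧ ∀ᶠ t in 𝓝 1, ρ t = 1 := by
  obtain ⟨n, hn⟩ := exists_nat_gt (1 / δ)
  have hn0 : (0 : ℝ) < n := lt_trans (by positivity) hn
  have hnδ : 1 / (n : ℝ) < δ := by
    rw [div_lt_comm₀ hn0 hδ]; exact hn
  let π : ℝ → I := projIcc (0 : ℝ) 1 zero_le_one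
  have hπ : ∀ (k : ℤ) (t : I), |(k : ℝ) - n * t| ≤ 1 → dist (π (k / n)) t < δ := by
    intro k t hk
    have h1 : π t = t := projIcc_val _ t
    have h2 : dist (π (k / n)) (π t) ≤ dist ((k : ℝ) / n) t := by
      simpa only [NNReal.coe_one, one_mul] using
        (LipschitzWith.projIcc (zero_le_one (α := ℝ))).dist_le_mul (k / n : ℝ) t
    rw [h1] at h2
    refine h2.trans_lt (lt_of_le_of_lt ?_ hnδ)
    rw [Real.dist_eq, show (k : ℝ) / n - t = (k - n * t) / n by field_simp, abs_div,
      abs_of_pos hn0]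
    gcongr
  have hcont : Continuous fun t : I => (n : ℝ) * t := by fun_prop
  have hr : ∀ (k : ℤ) (t : I), (k : ℝ) - 1 / 2 < n * t → (n : ℝ) * t < k + 1 / 2 →
      round ((n : ℝ) * t) = k := by
    intro k t h1 h2
    rw [round_eq, Int.floor_eq_iff]
    constructor <;> linarith
  refine ⟨fun t => π (round ((n : ℝ) * t) / n), fun t => hπ _ _ ?_, fun t₀ => ?_, ?_, ?_⟩
  · rw [abs_sub_comm]
    exact (abs_sub_round _).trans (by norm_num)
  · have h1 := Int.floor_le ((n : ℝ) * t₀)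
    have h2 := Int.lt_floor_add_one ((n : ℝ) * t₀)
    set k := ⌊(n : ℝ) * t₀⌋
    refine ⟨π (k / n), π ((k + 1 : ℤ) / n), hπ _ _ ?_, hπ _ _ ?_, ?_⟩
    · rw [abs_le]; constructor <;> linarith
    · push_cast; rw [abs_le]; constructor <;> linarith
    · have e1 := (hcont.tendsto t₀).eventually
        (lt_mem_nhds (show (k : ℝ) - 1 / 2 < n * t₀ by linarith))
      have e2 := (hcont.tendsto t₀).eventually
        (gt_mem_nhds (show (n : ℝ) * t₀ < k + 3 / 2 by linarith))
      filter_upwards [e1, e2] with t h3 h4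
      have h5 : k ≤ round ((n : ℝ) * t) := by
        rw [round_eq, Int.le_floor]; linarith
      have h6 : round ((n : ℝ) * t) < k + 2 := by
        rw [round_eq, Int.floor_lt]; push_cast; linarith
      obtain h7 | h7 : round ((n : ℝ) * t) = k ∨ round ((n : ℝ) * t) = k + 1 := by omega
      · exact Or.inl (by rw [h7])
      · exact Or.inr (by rw [h7])
  · have e1 := (hcont.tendsto 0).eventually
      (gt_mem_nhds (show (n : ℝ) * ((0 : I) : ℝ) < 1 / 2 by norm_num))
    filter_upwards [e1] with t ht
    have h0 : 0 ≤ (n : ℝ) * t := mul_nonneg hn0.le t.2.1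
    rw [hr 0 t (by push_cast; linarith) (by push_cast; linarith)]
    simp only [Int.cast_zero, zero_div]
    exact projIcc_left _
  · have e1 := (hcont.tendsto 1).eventually
      (lt_mem_nhds (show (n : ℝ) - 1 / 2 < (n : ℝ) * ((1 : I) : ℝ) by norm_num))
    filter_upwards [e1] with t ht
    have h0 : (n : ℝ) * t ≤ n := mul_le_of_le_one_right hn0.le t.2.2
    rw [hr n t (by push_cast; linarith) (by push_cast; linarith)]
    simp only [Int.cast_natCast]
    rw [div_self hn0.ne']
    exact projIcc_right _

lemma eq_zero_or_eq_one_or_mem_edgeInt (t : I) : t = 0 ∨ t = 1 ∨ t ∈ edgeInt := by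
  by_cases h0 : t = 0
  · exact Or.inl h0
  by_cases h1 : t = 1
  · exact Or.inr (Or.inl h1)
  exact Or.inr (Or.inr ⟨unitInterval.pos_iff_ne_zero.2 h0, unitInterval.lt_one_iff_ne_one.2 h1⟩)

lemma isOpen_edgeInt : IsOpen edgeInt :=
  (isOpen_lt continuous_const continuous_subtype_val).inter
    (isOpen_lt continuous_subtype_val continuous_const)

/-- A graph admits locally two-valued self-maps that are as close to the identity as prescribed
by an assignment of neighbourhoods. -/
lemma exists_locally_two_valued_graph {Γ : Type*} [TopologicalSpace Γ] (hΓ : IsGraph Γ)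
    {O : Γ → Set Γ} (hO : ∀ y, IsOpen (O y)) (hmem : ∀ y, y ∈ O y) :
    ∃ r : Γ → Γ, ∀ x, ∃ W ∈ 𝓝 x, ∃ y, ∃ p ∈ O y, ∃ q ∈ O y,
      ∀ z ∈ W, z ∈ O y ∧ (r z = p ∨ r z = q) := by
  obtain ⟨V, E, -, -, hend, hemb, hEV, hdisj, hcov, -, hclosed, hV⟩ := hΓ.cell_structure
  by_cases hone : ∃ v : Γ, (univ : Set Γ) = {v}
  · obtain ⟨v, hv⟩ := hone
    have hall : ∀ x : Γ, x = v := fun x => by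
      have : x ∈ (univ : Set Γ) := mem_univ x
      rwa [hv] at this
    exact ⟨id, fun x => ⟨univ, univ_mem, v, v, hmem v, v, hmem v, fun z _ =>
      ⟨by rw [hall z]; exact hmem v, Or.inl (hall z)⟩⟩⟩
  have hcov' : ∀ x : Γ, x ∈ V ∨ ∃ e ∈ E, ∃ t ∈ edgeInt, e t = x := fun x => by
    have : x ∈ V ∪ ⋃ e ∈ E, ⇑e '' edgeInt := by rw [hcov]; trivial
    simpa using this
  have hnotV : ∀ e ∈ E, ∀ t ∈ edgeInt, e t ∉ V := fun e he t ht hm => by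
    have : e t ∈ (⇑e '' edgeInt) ∩ V := ⟨mem_image_of_mem _ ht, hm⟩
    rwa [hEV e he] at this
  have hinj : ∀ e ∈ E, ∀ t ∈ edgeInt, ∀ e' ∈ E, ∀ t' ∈ edgeInt, e t = e' t' → e = e' ∧ t = t' := by
    intro e he t ht e' he' t' ht' h
    obtain rfl : e = e' := by
      by_contra hne
      have : e t ∈ (⇑e '' edgeInt) ∩ (⇑e' '' edgeInt) :=
        ⟨mem_image_of_mem _ ht, h ▸ mem_image_of_mem _ ht'⟩
      rwa [hdisj e he e' he' hne] at this
    refine ⟨rfl, ?_⟩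
    have := (hemb e he).injective (a₁ := ⟨t, ht⟩) (a₂ := ⟨t', ht'⟩) h
    simpa using this
  have hopen : ∀ W : Set Γ, (∀ e ∈ E, IsOpen (⇑e ⁻¹' W)) → IsOpen W := by
    intro W hW
    have h1 := hclosed Wᶜ fun e he => by
      rw [preimage_compl]; exact (hW e he).isClosed_compl
    have h2 : (⋃ e ∈ E, range ⇑e) = univ := by
      refine eq_univ_of_forall fun x => ?_
      rcases hcov' x with hx | ⟨e, he, t, -, rfl⟩
      · rcases hV x hx with ⟨e, he, hxe⟩ | h
        · exact mem_biUnion he hxe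
        · exact absurd ⟨x, h⟩ hone
      · exact mem_biUnion he (mem_range_self t)
    rw [h2, inter_univ] at h1
    exact isClosed_compl_iff.1 h1
  have hleb : ∀ e : C(I, Γ), ∃ δ > 0, ∀ t : I, ∃ y, Metric.ball t δ ⊆ e ⁻¹' O y := fun e => by
    obtain ⟨δ, hδ, h⟩ := lebesgue_number_lemma_of_metric (s := univ) (c := fun y => e ⁻¹' O y)
      isCompact_univ (fun y => (hO y).preimage e.continuous)
      fun t _ => mem_iUnion.2 ⟨e t, hmem (e t)⟩
    exact ⟨δ, hδ, fun t => h t (mem_univ t)⟩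
  choose δ hδ hball using hleb
  choose ρ hρ₁ hρ₂ hρ₃ hρ₄ using fun e => exists_locally_two_valued_interval (hδ e)
  have hr : ∀ x, ∃ y, (x ∈ V → y = x) ∧ ∀ e ∈ E, ∀ t ∈ edgeInt, e t = x → y = e (ρ e t) := by
    intro x
    rcases hcov' x with hx | ⟨e, he, t, ht, rfl⟩
    · exact ⟨x, fun _ => rfl, fun e he t ht h => absurd (h ▸ hx) (hnotV e he t ht)⟩
    · refine ⟨e (ρ e t), fun h => absurd h (hnotV e he t ht), fun e' he' t' ht' h => ?_⟩
      obtain ⟨rfl, rfl⟩ := hinj e' he' t' ht' e he t ht h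
      rfl
  choose r hrV hrE using hr
  refine ⟨r, fun x => ?_⟩
  rcases hcov' x with hx | ⟨e, he, t, ht, rfl⟩
  · let W : Set Γ := {z | z = x ∨ ∃ e ∈ E, ∃ t ∈ edgeInt, e t = z ∧
      ((e 0 = x ∧ t ∈ interior {t | ρ e t = 0}) ∨ (e 1 = x ∧ t ∈ interior {t | ρ e t = 1}))}
    have hW : IsOpen W := by
      refine hopen W fun e he => isOpen_iff_mem_nhds.2 fun t ht => ?_
      rcases eq_zero_or_eq_one_or_mem_edgeInt t with rfl | rfl | htI
      · have hx0 : e 0 = x := by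
          rcases ht with h | ⟨e', he', t', ht', h, -⟩
          · exact h
          · exact absurd (h ▸ (hend e he).1) (hnotV e' he' t' ht')
        have h0 : interior {t | ρ e t = 0} ∈ 𝓝 (0 : I) := interior_mem_nhds.2 (hρ₃ e)
        filter_upwards [h0, isOpen_ne.mem_nhds (zero_ne_one (α := I))] with s hs hs1
        rcases eq_zero_or_eq_one_or_mem_edgeInt s with rfl | rfl | hsI
        · exact Or.inl hx0
        · exact absurd rfl hs1
        · exact Or.inr ⟨e, he, s, hsI, rfl, Or.inl ⟨hx0, hs⟩⟩
      · have hx0 : e 1 = x := by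
          rcases ht with h | ⟨e', he', t', ht', h, -⟩
          · exact h
          · exact absurd (h ▸ (hend e he).2) (hnotV e' he' t' ht')
        have h0 : interior {t | ρ e t = 1} ∈ 𝓝 (1 : I) := interior_mem_nhds.2 (hρ₄ e)
        filter_upwards [h0, isOpen_ne.mem_nhds (zero_ne_one (α := I)).symm] with s hs hs1
        rcases eq_zero_or_eq_one_or_mem_edgeInt s with rfl | rfl | hsI
        · exact absurd rfl hs1
        · exact Or.inl hx0
        · exact Or.inr ⟨e, he, s, hsI, rfl, Or.inr ⟨hx0, hs⟩⟩
      · rcases ht with h | ⟨e', he', t', ht', h, h'⟩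
        · exact absurd (h ▸ hx) (hnotV e he t htI)
        · obtain ⟨rfl, rfl⟩ := hinj e' he' t' ht' e he t htI h
          rcases h' with ⟨h1, h2⟩ | ⟨h1, h2⟩
          · filter_upwards [isOpen_interior.mem_nhds h2, isOpen_edgeInt.mem_nhds htI] with s hs hsI
            exact Or.inr ⟨e', he, s, hsI, rfl, Or.inl ⟨h1, hs⟩⟩
          · filter_upwards [isOpen_interior.mem_nhds h2, isOpen_edgeInt.mem_nhds htI] with s hs hsI
            exact Or.inr ⟨e', he, s, hsI, rfl, Or.inr ⟨h1, hs⟩⟩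
    refine ⟨W ∩ O x, inter_mem (hW.mem_nhds (Or.inl rfl)) ((hO x).mem_nhds (hmem x)), x, x,
      hmem x, x, hmem x, fun z hz => ⟨hz.2, Or.inl ?_⟩⟩
    rcases hz.1 with rfl | ⟨e, he, t, ht, rfl, h⟩
    · exact hrV _ hx
    · rw [hrE _ e he t ht rfl]
      rcases h with ⟨h1, h2⟩ | ⟨h1, h2⟩ <;> have h3 := mem_ofPred.1 (interior_subset h2)
      · rw [h3, h1]
      · rw [h3, h1]
  · obtain ⟨a, b, ha, hb, hab⟩ := hρ₂ e t
    obtain ⟨y, hy⟩ := hball e t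
    obtain ⟨J, hJ, hJo, htJ⟩ := eventually_nhds_iff.1
      (hab.and (Metric.ball_mem_nhds t (hδ e)))
    have hW : IsOpen (e '' (J ∩ edgeInt)) := by
      refine hopen _ fun e' he' => isOpen_iff_mem_nhds.2 fun s hs => ?_
      obtain ⟨u, ⟨huJ, huI⟩, h⟩ := hs
      have hsI : s ∈ edgeInt := by
        rcases eq_zero_or_eq_one_or_mem_edgeInt s with rfl | rfl | hsI
        · exact absurd (h ▸ (hend e' he').1) (hnotV e he u huI)
        · exact absurd (h ▸ (hend e' he').2) (hnotV e he u huI)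
        · exact hsI
      obtain ⟨rfl, rfl⟩ := hinj e he u huI e' he' s hsI h
      filter_upwards [hJo.mem_nhds huJ, isOpen_edgeInt.mem_nhds huI] with w hw hwI
      exact mem_image_of_mem _ ⟨hw, hwI⟩
    refine ⟨_, hW.mem_nhds (mem_image_of_mem _ ⟨htJ, ht⟩), y, e a, hy ha, e b, hy hb, ?_⟩
    rintro _ ⟨s, ⟨hsJ, hsI⟩, rfl⟩
    obtain ⟨h1, h2⟩ := hJ s hsJ
    refine ⟨hy h2, ?_⟩
    rw [hrE _ e he s hsI rfl]
    exact h1.imp (congrArg e) (congrArg e)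

/-! ### Classes carried by a point die in spaces properly equivalent to graphs -/

section PointClass

variable {S Γ : Type*} [TopologicalSpace S] [TopologicalSpace Γ]

/-- The pullback of a class carried by a point along a proper map that factors through a graph
has a compactly supported primitive. -/
lemma triv_pull_of_factors [T2Space S] [LocallyCompactSpace S] (hΓ : IsGraph Γ) {φ : S → Γ}
    {ψ : Γ → S} (hφ : ProperCont φ) (hψ : ProperCont ψ) {c : S → S → S → ZMod 2} {x₀ : S}
    (hc : ∀ x, CocycleAt c x) (hz : ∀ x, x ≠ x₀ → EqAt2 c 0 x) : Triv (pull2 (ψ ∘ φ) c) := by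
  obtain ⟨D, hD, hDx₀⟩ := exists_compact_mem_nhds x₀
  have hT : ∀ s, ∃ T : Set S, IsOpen T ∧ s ∈ T ∧ CocycleOn2 c T ∧ (s = x₀ → T ⊆ D) ∧
      (s ≠ x₀ → ∀ p ∈ T, ∀ q ∈ T, ∀ r ∈ T, c p q r = 0) := fun s => by
    obtain ⟨V, hV, hVc⟩ := (hc s).exists_mem
    by_cases hs : s = x₀
    · obtain ⟨T, hTV, hTo, hsT⟩ := mem_nhds_iff.1 (inter_mem hV (hs ▸ hDx₀))
      exact ⟨T, hTo, hsT, hVc.mono fun x hx => (hTV hx).1, fun _ x hx => (hTV hx).2,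
        fun h => absurd hs h⟩
    · obtain ⟨V', hV', hVz⟩ := (hz s hs).exists_mem
      obtain ⟨T, hTV, hTo, hsT⟩ := mem_nhds_iff.1 (inter_mem hV hV')
      exact ⟨T, hTo, hsT, hVc.mono fun x hx => (hTV hx).1, fun h => absurd h hs,
        fun _ p hp q hq r hr => hVz p (hTV hp).2 q (hTV hq).2 r (hTV hr).2⟩
  choose T hTo hmem hTc hTD hTz using hT
  obtain ⟨r, hr⟩ := exists_locally_two_valued_graph hΓ (O := fun y => ψ ⁻¹' T (ψ y))
    (fun y => (hTo _).preimage hψ.1) fun y => hmem _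
  obtain ⟨b, hb, hb0⟩ := exists_primitive_of_two_valued (ψ ∘ φ) (ψ ∘ r ∘ φ) c
  have hbc : ∀ x, EqAt2 (pull2 (ψ ∘ φ) c) (d1 b) x := fun x => hb x <| by
    obtain ⟨W, hW, y, p, hp, q, hq, h⟩ := hr (φ x)
    refine ⟨φ ⁻¹' W, hφ.1.continuousAt hW, T (ψ y), hTc _, fun z hz => ⟨(h _ hz).1, ?_⟩,
      ψ p, hp, ψ q, hq, fun z hz => (h _ hz).2.imp (congrArg ψ) (congrArg ψ)⟩
    rcases (h _ hz).2 with h' | h'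
    · exact mem_of_eq_of_mem (congrArg ψ h') hp
    · exact mem_of_eq_of_mem (congrArg ψ h') hq
  have hbz : ∀ x ∉ φ ⁻¹' (ψ ⁻¹' D), EqAt1 b 0 x := fun x hx => hb0 x <| by
    obtain ⟨W, hW, y, p, hp, q, hq, h⟩ := hr (φ x)
    have hy : ψ y ≠ x₀ := fun hy => hx (hTD _ hy (h _ (mem_of_mem_nhds hW)).1)
    refine ⟨φ ⁻¹' W, hφ.1.continuousAt hW, T (ψ y), hTz _ hy, fun z hz => ⟨(h _ hz).1, ?_⟩⟩
    rcases (h _ hz).2 with h' | h'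
    · exact mem_of_eq_of_mem (congrArg ψ h') hp
    · exact mem_of_eq_of_mem (congrArg ψ h') hq
  obtain ⟨K, hK, hKD⟩ := exists_compact_superset (hφ.2 _ (hψ.2 _ hD))
  obtain ⟨b', h1, h2⟩ := exists_truncated_primitive (E := ∅) hK.isClosed
    (fun x hx => hbz x fun h => hx.2 (hKD h)) (fun x _ _ => hbc x)
    (fun x hx => (hbc x).trans (hbz x fun h => hx (hKD h)).d1_zero)
  exact ⟨K, hK, b', h1, fun x => h2 x (by simp)⟩

/-- A proper homotopy from `f` to the identity changes a class carried by a point by a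
compactly supported coboundary. -/
lemma triv_pull_add_of_phtpc_id [T2Space S] [LocallyCompactSpace S] {f : S → S}
    (hf : PHtpc f id) {c : S → S → S → ZMod 2} {x₀ : S} (hc : ∀ x, CocycleAt c x)
    (hz : ∀ x, x ≠ x₀ → EqAt2 c 0 x) : Triv (pull2 f c + c) := by
  obtain ⟨H, ⟨hH, hHp⟩, h0, h1⟩ := hf
  obtain ⟨b, K, hK, hbK, hb⟩ := exists_compact_primitive_of_homotopy hH (c := c)
    ((hHp {x₀} isCompact_singleton).image continuous_fst) hc
    fun x hx t => hz _ fun h => hx ⟨(x, t), h, rfl⟩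
  refine ⟨K, hK, b, hbK, fun x => ?_⟩
  have := hb x
  simp only [h0, h1] at this
  exact this

/-- A point of a space without boundary lies in the range of an open embedding of the plane. -/
lemma exists_isOpenEmbedding_of_bd_eq_empty (h : Bd S = ∅) (x : S) :
    ∃ e : ℝ × ℝ → S, IsOpenEmbedding e ∧ x ∈ range e := by
  have hx : x ∉ Bd S := by simp [h]
  obtain ⟨U, hU, hxU, ⟨g⟩⟩ := not_not.1 hx
  exact ⟨_, hU.isOpenEmbedding_subtypeVal.comp g.symm.isOpenEmbedding, g ⟨x, hxU⟩, by simp⟩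

lemma locallyCompactSpace_of_charts [T2Space S]
    (h : ∀ x : S, ∃ e : ℝ × ℝ → S, IsOpenEmbedding e ∧ x ∈ range e) : LocallyCompactSpace S := by
  have : WeaklyLocallyCompactSpace S := ⟨fun x => by
    obtain ⟨e, he, u, rfl⟩ := h x
    obtain ⟨K, hK, hKu⟩ := exists_compact_mem_nhds u
    exact ⟨e '' K, hK.image he.continuous, he.isOpenMap.image_mem_nhds hKu⟩⟩
  infer_instance

end PointClass

end AlexSpanier

/-- If `S` is a surface with empty boundary, then `S` is not properly
homotopy equivalent to any graph. -/
theorem not_PHE_graph_of_emptyBoundary (S : Type*) [TopologicalSpace S]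
    (hS : IsSurface S) (h : Bd S = ∅)
    (Γ : Type*) [TopologicalSpace Γ] (hΓ : IsGraph Γ) :
    ¬ PHEquivalent S Γ := by
  open AlexSpanier in
  rintro ⟨φ, ψ, hφ, hψ, hH, -⟩
  have : T2Space S := hS.t2
  have := locallyCompactSpace_of_charts (exists_isOpenEmbedding_of_bd_eq_empty h)
  choose e he hmem using exists_isOpenEmbedding_of_bd_eq_empty h
  obtain ⟨s⟩ := hS.connected.toNonempty
  have hpt : ∀ x ∉ ({0} : Set (ℝ × ℝ)), EqAt2 (pt 0) 0 x := fun x hx => pt_off hx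
  obtain ⟨c, hc, hce, hcz⟩ := exists_extension (c := pt 0) (he s) (fun x => cocycleAt_d1 _ x)
    isCompact_singleton hpt
  have hcz' : ∀ x, x ≠ e s 0 → EqAt2 c 0 x := fun x hx => hcz x (by simpa using hx)
  have ht : Triv c := (triv_pull_of_factors hΓ hφ hψ hc hcz').of_add
    (triv_pull_add_of_phtpc_id hH hc hcz')
  have h0 := tr_pull_eq_zero_of_triv he (fun x => ⟨x, hmem x⟩)
    (suppIn_of_point hc (mem_range_self 0) hcz') ht
  rw [tr_congr hce, tr_pt] at h0
  exact one_ne_zero h0
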